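/- Convergence in probability of the particle backward operator: assume (A1)-(A3), that sup_x G_n(x) < ∞ for every n ≥ 0, and that 1/G_n ∈ L_{v^δ} for every n ≥ 0 (δ as in (A1)). Let p > 0 and n ≥ p. Then for λ-a.e. x_p ∈ X and any bounded measurable F : X^{n+1} → R, the random variables [D_{p,n}^N − D_{p,n}](F)(x_p) converge to 0 in probability as N → ∞. -/

import Mathlib

open MeasureTheory ENNReal Filter Topology

noncomputable section

namespace FK

variable {X : Type} [MeasurableSpace X]
variable (lam mu : Measure X) (G : ℕ → X → ℝ) (H : ℕ → X → X → ℝ)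

/-- The one-step Feynman-Kac operator `Q_n(f)(x) = G_{n-1}(x) ∫ H_n(x,y) f(y) λ(dy)` (`n ≥ 1`). -/
def Qop (n : ℕ) (f : X → ℝ) (x : X) : ℝ :=
  G (n - 1) x * ∫ y, H n x y * f y ∂lam

/-- The semigroup `Q_{p,p+k}`. -/
def QsegAux (p : ℕ) : ℕ → (X → ℝ) → X → ℝ
  | 0, f => f
  | k + 1, f => QsegAux p k (Qop lam G H (p + k + 1) f)

/-- The semigroup `Q_{p,n}` (identity when `n ≤ p`). -/
def Qseg (p n : ℕ) (f : X → ℝ) : X → ℝ := QsegAux lam G H p (n - p) f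

/-- The unnormalized Feynman-Kac measures `γ_n`. -/
def gammaM : ℕ → Measure X
  | 0 => mu
  | n + 1 =>
      ((gammaM n).withDensity fun x => ENNReal.ofReal (G n x)).bind
        fun x => lam.withDensity fun y => ENNReal.ofReal (H (n + 1) x y)

/-- The predictor `η_n = γ_n/γ_n(1)`. -/
def eta (n : ℕ) : Measure X := (gammaM lam mu G H n Set.univ)⁻¹ • gammaM lam mu G H n

/-- `η_n(f)`. -/
def etaI (n : ℕ) (f : X → ℝ) : ℝ := ∫ x, f x ∂(eta lam mu G H n)

/-- `h_{p,n} = Q_{p,n}(1)/η_p(Q_{p,n}(1))`. -/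
def hfun (p n : ℕ) (x : X) : ℝ :=
  Qseg lam G H p n (fun _ => 1) x / etaI lam mu G H p (Qseg lam G H p n fun _ => 1)

/-- The backward kernel `M_{q,η_{q-1}}` acting on a function. -/
def Mback (q : ℕ) (f : X → ℝ) (x : X) : ℝ :=
  (∫ y, G (q - 1) y * H q y x * f y ∂(eta lam mu G H (q - 1))) /
    ∫ y, G (q - 1) y * H q y x ∂(eta lam mu G H (q - 1))

/-- `M_{q+k:q}` (iterated backward kernels). -/
def MbackAux (q : ℕ) : ℕ → (X → ℝ) → X → ℝ
  | 0, f => f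
  | k + 1, f => Mback lam mu G H (q + k + 1) (MbackAux q k f)

/-- `M_{p:q} = M_{p,η_{p-1}} ⋯ M_{q+1,η_q}`. -/
def MbackSeg (p q : ℕ) (f : X → ℝ) : X → ℝ := MbackAux lam mu G H q (p - q) f

/-- Integration of a function of `(x_0,…,x_{n-1})` with respect to the backward path kernel
`\mathcal{M}_n(x_n, dx_{0:n-1})` built from the measure sequence `etaSeq`. -/
def Bpath (etaSeq : ℕ → Measure X) : (n : ℕ) → X → ((Fin n → X) → ℝ) → ℝ
  | 0, _, F => F fun i => i.elim0
  | n + 1, x, F =>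
      (∫ y, G n y * H (n + 1) y x * Bpath etaSeq n y (fun z => F (Fin.snoc z y)) ∂(etaSeq n)) /
        ∫ y, G n y * H (n + 1) y x ∂(etaSeq n)

/-- Integration of a function of `(x_{p+1},…,x_{p+k})` with respect to the forward path kernel
`\mathcal{Q}_{p,p+k}(x_p, dx_{p+1:p+k})`. -/
def Fpath : (p : ℕ) → (k : ℕ) → X → ((Fin k → X) → ℝ) → ℝ
  | _, 0, _, F => F fun i => i.elim0
  | p, k + 1, x, F =>
      G p x * ∫ y, H (p + 1) x y * Fpath (p + 1) k y (fun z => F (Fin.cons y z)) ∂lam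

/-- The operator `D_{p,n}` (with the measure sequence `etaSeq` used in the backward kernels):
`D_{p,n}(F)(x_p) = ∫ \mathcal{M}_p(x_p,dx_{0:p-1}) \mathcal{Q}_{p,n}(x_p,dx_{p+1:n}) F(x_{0:n})`. -/
def Dop (etaSeq : ℕ → Measure X) (p n : ℕ) (F : (Fin (n + 1) → X) → ℝ) (x : X) : ℝ :=
  if h : p ≤ n then
    Bpath G H etaSeq p x fun back =>
      Fpath lam G H p (n - p) x fun fwd =>
        F fun i => Fin.append (Fin.snoc back x) fwd (Fin.cast (by omega) i)
  else 0

/-- The smoother `∫ F(x_{0:n}) outer(dx_n) \mathcal{M}_n(x_n, dx_{0:n-1})`. -/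
def smoother (etaSeq : ℕ → Measure X) (outer : Measure X) (n : ℕ)
    (F : (Fin (n + 1) → X) → ℝ) : ℝ :=
  ∫ x, Bpath G H etaSeq n x (fun back => F (Fin.snoc back x)) ∂outer

/-- The asymptotic variance `σ_n²(F_n)`. -/
def sigmaSq (n : ℕ) (F : (Fin (n + 1) → X) → ℝ) : ℝ :=
  ∑ p ∈ Finset.range (n + 1),
    ∫ x,
      (hfun lam mu G H p n x *
          (Dop lam G H (eta lam mu G H) p n F x /
              Dop lam G H (eta lam mu G H) p n (fun _ => 1) x -
            etaI lam mu G H p (Dop lam G H (eta lam mu G H) p n F) /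
              etaI lam mu G H p (Dop lam G H (eta lam mu G H) p n fun _ => 1))) ^ 2
      ∂(eta lam mu G H p)

/-- Empirical measure of a particle configuration. -/
def emp (N : ℕ) (c : Fin N → X) : Measure X :=
  ((N : ℝ≥0∞))⁻¹ • ∑ i : Fin N, Measure.dirac (c i)

/-- The selection/mutation operator `Φ_p(μ) = μ(G_{p-1}M_p)/μ(G_{p-1})`. -/
def PhiMeas (p : ℕ) (μ : Measure X) : Measure X :=
  (∫⁻ x, ENNReal.ofReal (G (p - 1) x) ∂μ)⁻¹ •
    ((μ.withDensity fun x => ENNReal.ofReal (G (p - 1) x)).bind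
      fun x => lam.withDensity fun y => ENNReal.ofReal (H p x y))

/-- The joint law of the particle system `(x_0^{1:N},…,x_n^{1:N})`. -/
def particleLaw (N : ℕ) : (n : ℕ) → Measure (Fin (n + 1) → Fin N → X)
  | 0 => (Measure.pi fun _ : Fin N => mu).map fun c => fun _ : Fin 1 => c
  | n + 1 =>
      (particleLaw N n).bind fun traj =>
        (Measure.pi fun _ : Fin N =>
            PhiMeas lam G H (n + 1) (emp N (traj (Fin.last n)))).map
          fun c => Fin.snoc traj c

/-- The sequence of empirical measures `η_q^N` extracted from a particle trajectory. -/
def empSeq (N n : ℕ) (traj : Fin (n + 1) → Fin N → X) (q : ℕ) : Measure X :=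
  if h : q < n + 1 then emp N (traj ⟨q, h⟩) else 0

/-- Expectation along the doubled (tensorized) inhomogeneous Markov chain started at time `p`
from the point `z ∈ X²`, over the path `(X̄_p,…,X̄_{p+k})`. -/
def chainE : (p : ℕ) → (k : ℕ) → X × X → ((Fin (k + 1) → X × X) → ℝ) → ℝ
  | _, 0, z, F => F fun _ => z
  | p, k + 1, z, F =>
      ∫ w : X × X,
        H (p + 1) z.1 w.1 * H (p + 1) z.2 w.2 *
          chainE (p + 1) k w (fun path => F (Fin.cons z path)) ∂(lam.prod lam)

end FK

open MeasureTheory ENNReal Filter Topology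

set_option linter.unusedSectionVars false

namespace FK

open ProbabilityTheory

section

variable {X : Type} [MeasurableSpace X]

/-- Regularity of the potentials and of the transition densities: measurability, nonnegativity,
boundedness of the potentials, and unit mass of the transition densities. -/
structure IsRegular (lam : Measure X) (G : ℕ → X → ℝ) (H : ℕ → X → X → ℝ) : Prop where
  measurable_G : ∀ n, Measurable (G n)
  G_nonneg : ∀ n x, 0 ≤ G n x
  measurable_H : ∀ n, Measurable (Function.uncurry (H n))
  H_nonneg : ∀ n x y, 0 ≤ H n x y
  integral_H : ∀ n, 1 ≤ n → ∀ x, ∫ y, H n x y ∂lam = 1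
  bounded_G : ∀ n, ∃ C : ℝ, ∀ x, G n x ≤ C

/-- The mutation kernel with density `H_n` with respect to `lam`. -/
def mutation (lam : Measure X) [SigmaFinite lam] {G : ℕ → X → ℝ} {H : ℕ → X → X → ℝ}
    (hr : IsRegular lam G H) (n : ℕ) : Kernel X X where
  toFun x := lam.withDensity fun y => ENNReal.ofReal (H n x y)
  measurable' := by
    refine Measure.measurable_of_measurable_coe _ fun s hs => ?_
    simp only [withDensity_apply _ hs]
    exact Measurable.lintegral_prod_right'
      (f := fun z : X × X => ENNReal.ofReal (H n z.1 z.2))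
      (hr.measurable_H n).ennreal_ofReal

/-- The unnormalized selection and mutation step `ν ↦ ν(G_n M_{n+1})`. -/
def stepM (lam : Measure X) (G : ℕ → X → ℝ) (H : ℕ → X → X → ℝ) (n : ℕ) (ν : Measure X) :
    Measure X :=
  (ν.withDensity fun x => ENNReal.ofReal (G n x)).bind
    fun x => lam.withDensity fun y => ENNReal.ofReal (H (n + 1) x y)

variable {lam mu : Measure X} [SigmaFinite lam] {G : ℕ → X → ℝ} {H : ℕ → X → X → ℝ}

namespace IsRegular

variable (hr : IsRegular lam G H)
include hr

lemma lintegral_H (n : ℕ) (x : X) : ∫⁻ y, ENNReal.ofReal (H (n + 1) x y) ∂lam = 1 := by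
  have h := hr.integral_H (n + 1) (by omega) x
  rw [integral_eq_lintegral_of_nonneg_ae (ae_of_all _ fun y => hr.H_nonneg _ _ _)] at h
  · rwa [ENNReal.toReal_eq_one_iff] at h
  · exact ((hr.measurable_H (n + 1)).comp measurable_prodMk_left).aestronglyMeasurable

lemma measurable_ofReal_G (n : ℕ) : Measurable fun x => ENNReal.ofReal (G n x) :=
  (hr.measurable_G n).ennreal_ofReal

lemma measurable_ofReal_H (n : ℕ) :
    Measurable fun z : X × X => ENNReal.ofReal (H n z.1 z.2) :=
  (hr.measurable_H n).ennreal_ofReal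

lemma measurable_ofReal_H_right (n : ℕ) (x : X) :
    Measurable fun y => ENNReal.ofReal (H n x y) :=
  (hr.measurable_ofReal_H n).comp measurable_prodMk_left

lemma measurable_H_left (n : ℕ) (y : X) : Measurable fun x => H n x y :=
  (hr.measurable_H n).comp measurable_prodMk_right

lemma isProbabilityMeasure_mutation (n : ℕ) (x : X) :
    IsProbabilityMeasure (mutation lam hr (n + 1) x) :=
  ⟨by
    change (lam.withDensity fun y => ENNReal.ofReal (H (n + 1) x y)) Set.univ = 1
    rw [withDensity_apply _ MeasurableSet.univ, setLIntegral_univ, hr.lintegral_H]⟩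

lemma isMarkovKernel_mutation (n : ℕ) : IsMarkovKernel (mutation lam hr (n + 1)) :=
  ⟨hr.isProbabilityMeasure_mutation n⟩

lemma lintegral_mutation (n : ℕ) (x : X) {f : X → ℝ≥0∞} (hf : Measurable f) :
    ∫⁻ y, f y ∂(mutation lam hr n x) = ∫⁻ y, ENNReal.ofReal (H n x y) * f y ∂lam :=
  lintegral_withDensity_eq_lintegral_mul _ (hr.measurable_ofReal_H_right n x) hf

lemma lintegral_stepM_eq_mutation (n : ℕ) (ν : Measure X) {f : X → ℝ≥0∞} (hf : Measurable f) :
    ∫⁻ y, f y ∂(stepM lam G H n ν) =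
      ∫⁻ x, ENNReal.ofReal (G n x) * ∫⁻ y, f y ∂(mutation lam hr (n + 1) x) ∂ν := by
  have h1 : ∫⁻ y, f y ∂(stepM lam G H n ν) =
      ∫⁻ x, ∫⁻ y, f y ∂(mutation lam hr (n + 1) x)
        ∂(ν.withDensity fun x => ENNReal.ofReal (G n x)) :=
    Measure.lintegral_bind (mutation lam hr (n + 1)).measurable.aemeasurable hf.aemeasurable
  rw [h1]
  exact lintegral_withDensity_eq_lintegral_mul _ (hr.measurable_ofReal_G n)
    ((Measure.measurable_lintegral hf).comp (mutation lam hr (n + 1)).measurable)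

lemma lintegral_stepM (n : ℕ) (ν : Measure X) {f : X → ℝ≥0∞} (hf : Measurable f) :
    ∫⁻ y, f y ∂(stepM lam G H n ν) =
      ∫⁻ x, ENNReal.ofReal (G n x) * ∫⁻ y, ENNReal.ofReal (H (n + 1) x y) * f y ∂lam ∂ν := by
  simp_rw [hr.lintegral_stepM_eq_mutation n ν hf, hr.lintegral_mutation _ _ hf]

lemma lintegral_stepM_swap (n : ℕ) (ν : Measure X) [SFinite ν] {f : X → ℝ≥0∞}
    (hf : Measurable f) :
    ∫⁻ y, f y ∂(stepM lam G H n ν) =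
      ∫⁻ y, f y * ∫⁻ x, ENNReal.ofReal (G n x * H (n + 1) x y) ∂ν ∂lam := by
  have hm : Measurable (Function.uncurry fun x y : X =>
      f y * ENNReal.ofReal (G n x * H (n + 1) x y)) :=
    (hf.comp measurable_snd).mul
      (((hr.measurable_G n).comp measurable_fst).mul (hr.measurable_H (n + 1))).ennreal_ofReal
  rw [hr.lintegral_stepM n ν hf]
  have h1 : ∀ x, ENNReal.ofReal (G n x) * ∫⁻ y, ENNReal.ofReal (H (n + 1) x y) * f y ∂lam =
      ∫⁻ y, f y * ENNReal.ofReal (G n x * H (n + 1) x y) ∂lam := by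
    intro x
    rw [← lintegral_const_mul _
      (f := fun y => ENNReal.ofReal (H (n + 1) x y) * f y)
      ((hr.measurable_ofReal_H_right _ x).mul hf)]
    refine lintegral_congr fun y => ?_
    rw [ENNReal.ofReal_mul (hr.G_nonneg n x)]
    ring
  simp_rw [h1]
  rw [lintegral_lintegral_swap hm.aemeasurable]
  refine lintegral_congr fun y => ?_
  exact lintegral_const_mul _
    (((hr.measurable_G n).mul (hr.measurable_H_left (n + 1) y)).ennreal_ofReal)

lemma stepM_univ (n : ℕ) (ν : Measure X) :
    stepM lam G H n ν Set.univ = ∫⁻ x, ENNReal.ofReal (G n x) ∂ν := by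
  rw [← lintegral_one, hr.lintegral_stepM n ν measurable_const]
  simp [hr.lintegral_H]

lemma lintegral_G_lt_top (n : ℕ) (ν : Measure X) [IsFiniteMeasure ν] :
    ∫⁻ x, ENNReal.ofReal (G n x) ∂ν < ∞ := by
  obtain ⟨C, hC⟩ := hr.bounded_G n
  calc ∫⁻ x, ENNReal.ofReal (G n x) ∂ν ≤ ∫⁻ _, ENNReal.ofReal C ∂ν :=
        lintegral_mono fun x => ENNReal.ofReal_le_ofReal (hC x)
    _ < ∞ := by
        rw [lintegral_const]
        exact ENNReal.mul_lt_top ENNReal.ofReal_lt_top (measure_lt_top _ _)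

lemma isFiniteMeasure_stepM (n : ℕ) (ν : Measure X) [IsFiniteMeasure ν] :
    IsFiniteMeasure (stepM lam G H n ν) :=
  ⟨by rw [hr.stepM_univ]; exact hr.lintegral_G_lt_top n ν⟩

lemma isFiniteMeasure_gammaM [IsFiniteMeasure mu] (n : ℕ) :
    IsFiniteMeasure (gammaM lam mu G H n) := by
  induction n with
  | zero => simpa [gammaM]
  | succ n ih => exact hr.isFiniteMeasure_stepM n _

/-- The one-step Feynman-Kac operator acts on integrable functions and is dual to `stepM`. -/
lemma integral_stepM (n : ℕ) (ν : Measure X) {f : X → ℝ}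
    (hf : Integrable f (stepM lam G H n ν)) :
    Integrable (fun x => G n x * ∫ y, f y ∂(mutation lam hr (n + 1) x)) ν ∧
      ∫ y, f y ∂(stepM lam G H n ν) =
        ∫ x, G n x * ∫ y, f y ∂(mutation lam hr (n + 1) x) ∂ν := by
  have := hr.isMarkovKernel_mutation n
  have hG : Measurable fun x => (G n x).toNNReal := (hr.measurable_G n).real_toNNReal
  have e : stepM lam G H n ν =
      ((mutation lam hr (n + 1)) ∘ₖ (Kernel.const Unit
        (ν.withDensity fun x => ENNReal.ofReal (G n x)))) () := by
    rw [← Measure.comp_eq_comp_const_apply]; rfl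
  rw [e] at hf ⊢
  have h1 := hf.integral_comp
  rw [Kernel.integral_comp hf]
  rw [Kernel.const_apply] at h1 ⊢
  constructor
  · have h2 := (integrable_withDensity_iff_integrable_smul (μ := ν) hG).1 h1
    refine h2.congr (ae_of_all _ fun x => ?_)
    simp only [NNReal.smul_def, Real.coe_toNNReal _ (hr.G_nonneg n x), smul_eq_mul]
  · have h2 := integral_withDensity_eq_integral_smul (μ := ν) hG
      (fun x => ∫ y, f y ∂(mutation lam hr (n + 1) x))
    refine h2.trans (integral_congr_ae (ae_of_all _ fun x => ?_))
    simp only [NNReal.smul_def, Real.coe_toNNReal _ (hr.G_nonneg n x), smul_eq_mul]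

lemma measurable_G_mul_integral (n : ℕ) {f : X → ℝ} (hf : Measurable f) :
    Measurable fun x => G n x * ∫ y, f y ∂(mutation lam hr (n + 1) x) := by
  have := hr.isMarkovKernel_mutation n
  refine (hr.measurable_G n).mul (StronglyMeasurable.measurable ?_)
  exact (hf.comp measurable_snd).stronglyMeasurable.integral_kernel_prod_right'
    (κ := mutation lam hr (n + 1)) (f := fun z : X × X => f z.2)

lemma measurable_stepM (n : ℕ) : Measurable fun ν : Measure X => stepM lam G H n ν := by
  refine Measure.measurable_of_measurable_coe _ fun s hs => ?_
  have hs' : Measurable (s.indicator (1 : X → ℝ≥0∞)) := measurable_one.indicator hs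
  have h (ν : Measure X) := hr.lintegral_stepM_eq_mutation n ν hs'
  simp only [lintegral_indicator_one hs] at h
  simp_rw [h]
  exact Measure.measurable_lintegral
    ((hr.measurable_ofReal_G n).mul ((mutation lam hr (n + 1)).measurable_coe hs))

lemma measurable_PhiMeas (n : ℕ) :
    Measurable fun ν : Measure X => PhiMeas lam G H (n + 1) ν := by
  refine Measure.measurable_of_measurable_coe _ fun s hs => ?_
  exact (Measure.measurable_lintegral (hr.measurable_ofReal_G n)).inv.mul
    ((Measure.measurable_coe hs).comp (hr.measurable_stepM n))

omit [SigmaFinite lam] hr in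
lemma PhiMeas_eq (n : ℕ) (ν : Measure X) :
    PhiMeas lam G H (n + 1) ν = (∫⁻ x, ENNReal.ofReal (G n x) ∂ν)⁻¹ • stepM lam G H n ν := rfl

lemma PhiMeas_univ_le_one (n : ℕ) (ν : Measure X) :
    PhiMeas lam G H (n + 1) ν Set.univ ≤ 1 := by
  rw [PhiMeas_eq, Measure.smul_apply, hr.stepM_univ, smul_eq_mul]
  exact ENNReal.inv_mul_le_one _

lemma isFiniteMeasure_PhiMeas (n : ℕ) (ν : Measure X) :
    IsFiniteMeasure (PhiMeas lam G H (n + 1) ν) :=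
  ⟨(hr.PhiMeas_univ_le_one n ν).trans_lt one_lt_top⟩

lemma PhiMeas_eq_zero (n : ℕ) (ν : Measure X) (h : ∫⁻ x, ENNReal.ofReal (G n x) ∂ν = 0) :
    PhiMeas lam G H (n + 1) ν = 0 := by
  have : stepM lam G H n ν = 0 := by
    rw [← Measure.measure_univ_eq_zero, hr.stepM_univ, h]
  rw [PhiMeas_eq, this, smul_zero]

lemma isProbabilityMeasure_PhiMeas (n : ℕ) (ν : Measure X) [IsFiniteMeasure ν]
    (h : ∫⁻ x, ENNReal.ofReal (G n x) ∂ν ≠ 0) :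
    IsProbabilityMeasure (PhiMeas lam G H (n + 1) ν) :=
  ⟨by
    rw [PhiMeas_eq, Measure.smul_apply, hr.stepM_univ, smul_eq_mul]
    exact ENNReal.inv_mul_cancel h (hr.lintegral_G_lt_top n ν).ne⟩

lemma mul_PhiMeas_le (n : ℕ) (ν : Measure X) (f : X → ℝ≥0∞) :
    (∫⁻ x, ENNReal.ofReal (G n x) ∂ν) * ∫⁻ y, f y ∂(PhiMeas lam G H (n + 1) ν) ≤
      ∫⁻ y, f y ∂(stepM lam G H n ν) := by
  rw [PhiMeas_eq, lintegral_smul_measure, smul_eq_mul, ← mul_assoc]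
  exact mul_le_of_le_one_left' (ENNReal.mul_inv_le_one _)

lemma mul_enorm_integral_PhiMeas_le (n : ℕ) (ν : Measure X) (f : X → ℝ) :
    (∫⁻ x, ENNReal.ofReal (G n x) ∂ν) * ‖∫ y, f y ∂(PhiMeas lam G H (n + 1) ν)‖ₑ ≤
      ‖∫ y, f y ∂(stepM lam G H n ν)‖ₑ := by
  rw [PhiMeas_eq, integral_smul_measure, enorm_smul, ← mul_assoc]
  refine mul_le_of_le_one_left' ?_
  rw [Real.enorm_of_nonneg ENNReal.toReal_nonneg]
  exact (mul_le_mul_right ENNReal.ofReal_toReal_le _).trans (ENNReal.mul_inv_le_one _)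

end IsRegular

end

section

variable {X : Type} [MeasurableSpace X]

section Empirical

lemma lintegral_emp (N : ℕ) (c : Fin N → X) {f : X → ℝ≥0∞} (hf : Measurable f) :
    ∫⁻ x, f x ∂(emp N c) = (N : ℝ≥0∞)⁻¹ * ∑ i, f (c i) := by
  simp only [emp, lintegral_smul_measure, lintegral_finsetSum_measure, lintegral_dirac' _ hf,
    smul_eq_mul]

lemma integrable_emp (N : ℕ) (c : Fin N → X) {f : X → ℝ} (hf : Measurable f) :
    Integrable f (emp N c) := by
  rcases Nat.eq_zero_or_pos N with rfl | hN
  · simp [emp]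
  · refine Integrable.smul_measure ?_ (by simp; omega)
    refine integrable_finsetSum_measure.2 fun i _ => ?_
    exact integrable_dirac' hf.stronglyMeasurable (by simp)

lemma integral_emp (N : ℕ) (c : Fin N → X) {f : X → ℝ} (hf : Measurable f) :
    ∫ x, f x ∂(emp N c) = (N : ℝ)⁻¹ * ∑ i, f (c i) := by
  have h : ∀ i ∈ (Finset.univ : Finset (Fin N)), Integrable f (Measure.dirac (c i)) := fun i _ =>
    integrable_dirac' hf.stronglyMeasurable (by simp)
  simp only [emp, integral_smul_measure, integral_finsetSum_measure h,
    integral_dirac' _ _ hf.stronglyMeasurable, smul_eq_mul]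
  simp

lemma emp_univ_le_one (N : ℕ) (c : Fin N → X) : emp N c Set.univ ≤ 1 := by
  rw [← lintegral_one, lintegral_emp N c measurable_const]
  simp [ENNReal.inv_mul_le_one]

instance isFiniteMeasure_emp (N : ℕ) (c : Fin N → X) : IsFiniteMeasure (emp N c) :=
  ⟨(emp_univ_le_one N c).trans_lt one_lt_top⟩

lemma isProbabilityMeasure_emp (N : ℕ) (hN : N ≠ 0) (c : Fin N → X) :
    IsProbabilityMeasure (emp N c) :=
  ⟨by
    rw [← lintegral_one, lintegral_emp N c measurable_const]
    simpa using ENNReal.inv_mul_cancel (by simpa) (by simp)⟩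

lemma measurable_emp (N : ℕ) : Measurable fun c : Fin N → X => emp N c := by
  refine Measure.measurable_of_measurable_coe _ fun s hs => ?_
  have h (c : Fin N → X) := lintegral_emp N c (measurable_one.indicator hs : Measurable _)
  simp only [lintegral_indicator_one hs] at h
  simp_rw [h]
  refine Measurable.const_mul (Finset.measurable_sum _ fun i _ => ?_) _
  exact (measurable_one.indicator hs).comp (measurable_pi_apply i)

end Empirical

/-- Measurability of a power of a measurable family of finite measures. -/
lemma measurable_pi_const {Ω : Type*} [MeasurableSpace Ω] {ν : Ω → Measure X}
    (hν : Measurable ν) (hfin : ∀ ω, IsFiniteMeasure (ν ω)) (N : ℕ) :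
    Measurable fun ω => Measure.pi fun _ : Fin N => ν ω := by
  refine Measurable.measure_of_isPiSystem generateFrom_pi.symm isPiSystem_pi ?_ ?_
  · rintro _ ⟨s, hs, rfl⟩
    simp only [Measure.pi_pi]
    refine Finset.measurable_prod _ fun i _ => ?_
    exact (Measure.measurable_coe (hs i (Set.mem_univ i))).comp hν
  · simp only [Measure.pi_univ]
    exact Finset.measurable_prod _ fun i _ => (Measure.measurable_coe MeasurableSet.univ).comp hν

lemma measurable_snoc {Y : Type*} [MeasurableSpace Y] (n : ℕ) :
    Measurable fun z : (Fin n → Y) × Y => (Fin.snoc z.1 z.2 : Fin (n + 1) → Y) := by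
  refine measurable_pi_iff.2 fun i => ?_
  refine Fin.lastCases ?_ (fun j => ?_) i
  · simpa using measurable_snd
  · simpa [Function.comp_def] using (measurable_pi_apply j).comp (measurable_fst (α := Fin n → Y) (β := Y))

lemma measurable_cons {Y : Type*} [MeasurableSpace Y] (n : ℕ) :
    Measurable fun z : Y × (Fin n → Y) => (Fin.cons z.1 z.2 : Fin (n + 1) → Y) := by
  refine measurable_pi_iff.2 fun i => ?_
  refine Fin.cases ?_ (fun j => ?_) i
  · simpa using measurable_fst
  · simpa [Function.comp_def] using (measurable_pi_apply j).comp (measurable_snd (α := Y) (β := Fin n → Y))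

variable {lam mu : Measure X} [SigmaFinite lam] {G : ℕ → X → ℝ} {H : ℕ → X → X → ℝ}

/-- The law of the `N` particles at time `n + 1` given the trajectory up to time `n`. -/
def nextKernel (lam : Measure X) [SigmaFinite lam] {G : ℕ → X → ℝ} {H : ℕ → X → X → ℝ}
    (hr : IsRegular lam G H) (N n : ℕ) : Kernel (Fin (n + 1) → Fin N → X) (Fin N → X) where
  toFun traj := Measure.pi fun _ : Fin N => PhiMeas lam G H (n + 1) (emp N (traj (Fin.last n)))
  measurable' := by
    refine measurable_pi_const
      (ν := fun traj : Fin (n + 1) → Fin N → X =>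
        PhiMeas lam G H (n + 1) (emp N (traj (Fin.last n)))) ?_
      (fun ω => hr.isFiniteMeasure_PhiMeas n _) N
    exact (hr.measurable_PhiMeas n).comp
      ((measurable_emp N).comp (measurable_pi_apply (Fin.last n)))

/-- The product of the empirical masses of the potentials before time `n`. -/
def weight (G : ℕ → X → ℝ) (N n : ℕ) (traj : Fin (n + 1) → Fin N → X) : ℝ≥0∞ :=
  ∏ k : Fin n, ∫⁻ x, ENNReal.ofReal (G k x) ∂(emp N (traj k.castSucc))

/-- The law of the particle system weighted by the particle estimate of `γ_n(1)`. -/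
def tilted (lam mu : Measure X) (G : ℕ → X → ℝ) (H : ℕ → X → X → ℝ) (N n : ℕ) :
    Measure (Fin (n + 1) → Fin N → X) :=
  (particleLaw lam mu G H N n).withDensity (weight G N n)

lemma weight_snoc (N n : ℕ) (traj : Fin (n + 1) → Fin N → X) (c : Fin N → X) :
    weight G N (n + 1) (Fin.snoc traj c) =
      weight G N n traj * ∫⁻ x, ENNReal.ofReal (G n x) ∂(emp N (traj (Fin.last n))) := by
  simp only [weight, Fin.prod_univ_castSucc, Fin.snoc_castSucc, Fin.val_castSucc, Fin.val_last]

namespace IsRegular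

variable (hr : IsRegular lam G H)
include hr

lemma nextKernel_apply (N n : ℕ) (traj : Fin (n + 1) → Fin N → X) :
    nextKernel lam hr N n traj =
      Measure.pi fun _ : Fin N => PhiMeas lam G H (n + 1) (emp N (traj (Fin.last n))) := rfl

lemma nextKernel_univ_le_one (N n : ℕ) (traj : Fin (n + 1) → Fin N → X) :
    nextKernel lam hr N n traj Set.univ ≤ 1 := by
  have := hr.isFiniteMeasure_PhiMeas n (emp N (traj (Fin.last n)))
  rw [nextKernel_apply, Measure.pi_univ]
  exact Finset.prod_le_one' fun i _ => hr.PhiMeas_univ_le_one n _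

lemma isFiniteKernel_nextKernel (N n : ℕ) : IsFiniteKernel (nextKernel lam hr N n) :=
  ⟨1, one_lt_top, hr.nextKernel_univ_le_one N n⟩

lemma lintegral_particleLaw_succ (N n : ℕ) {f : (Fin (n + 2) → Fin N → X) → ℝ≥0∞}
    (hf : Measurable f) :
    ∫⁻ t, f t ∂(particleLaw lam mu G H N (n + 1)) =
      ∫⁻ t, ∫⁻ c, f (Fin.snoc t c) ∂(nextKernel lam hr N n t)
        ∂(particleLaw lam mu G H N n) := by
  have := hr.isFiniteKernel_nextKernel N n
  have hs : ∀ t : Fin (n + 1) → Fin N → X,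
      Measurable fun c : Fin N → X => (Fin.snoc t c : Fin (n + 2) → Fin N → X) := fun t =>
    (measurable_snoc (n + 1)).comp measurable_prodMk_left
  have hm : Measurable fun t : Fin (n + 1) → Fin N → X =>
      (nextKernel lam hr N n t).map fun c => (Fin.snoc t c : Fin (n + 2) → Fin N → X) := by
    refine Measure.measurable_of_measurable_coe _ fun s hs' => ?_
    simp_rw [Measure.map_apply (hs _) hs']
    exact Kernel.measurable_kernel_prodMk_left (κ := nextKernel lam hr N n)
      (measurable_snoc (n + 1) hs')
  have h := Measure.lintegral_bind (m := particleLaw lam mu G H N n) hm.aemeasurable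
    (f := f) hf.aemeasurable
  refine h.trans (lintegral_congr fun t => ?_)
  exact lintegral_map hf (hs t)

lemma measurable_lintegral_nextKernel (N n : ℕ) {f : (Fin (n + 2) → Fin N → X) → ℝ≥0∞}
    (hf : Measurable f) :
    Measurable fun t => ∫⁻ c, f (Fin.snoc t c) ∂(nextKernel lam hr N n t) := by
  have := hr.isFiniteKernel_nextKernel N n
  exact Measurable.lintegral_kernel_prod_right' (κ := nextKernel lam hr N n)
    (hf.comp (measurable_snoc (n + 1)))

lemma measurable_lintegral_emp (N n : ℕ) {f : X → ℝ≥0∞} (hf : Measurable f) (k : Fin n) :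
    Measurable fun t : Fin n → Fin N → X => ∫⁻ x, f x ∂(emp N (t k)) :=
  (Measure.measurable_lintegral hf).comp ((measurable_emp N).comp (measurable_pi_apply k))

lemma measurable_weight (N n : ℕ) : Measurable (weight G N n) :=
  Finset.measurable_prod _ fun k _ =>
    hr.measurable_lintegral_emp N (n + 1) (hr.measurable_ofReal_G k) k.castSucc

lemma lintegral_tilted (N n : ℕ) {f : (Fin (n + 1) → Fin N → X) → ℝ≥0∞} (hf : Measurable f) :
    ∫⁻ t, f t ∂(tilted lam mu G H N n) =
      ∫⁻ t, weight G N n t * f t ∂(particleLaw lam mu G H N n) :=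
  lintegral_withDensity_eq_lintegral_mul _ (hr.measurable_weight N n) hf

lemma lintegral_tilted_zero (N : ℕ) {f : (Fin 1 → Fin N → X) → ℝ≥0∞} (hf : Measurable f) :
    ∫⁻ t, f t ∂(tilted lam mu G H N 0) =
      ∫⁻ c, f (fun _ => c) ∂(Measure.pi fun _ : Fin N => mu) := by
  rw [hr.lintegral_tilted N 0 hf]
  simp only [weight, Finset.univ_eq_empty, Finset.prod_empty, one_mul, particleLaw]
  exact lintegral_map hf (measurable_pi_iff.2 fun _ => measurable_id)

lemma lintegral_tilted_succ (N n : ℕ) {f : (Fin (n + 2) → Fin N → X) → ℝ≥0∞}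
    (hf : Measurable f) :
    ∫⁻ t, f t ∂(tilted lam mu G H N (n + 1)) =
      ∫⁻ t, (∫⁻ x, ENNReal.ofReal (G n x) ∂(emp N (t (Fin.last n)))) *
        ∫⁻ c, f (Fin.snoc t c) ∂(nextKernel lam hr N n t) ∂(tilted lam mu G H N n) := by
  rw [hr.lintegral_tilted N (n + 1) hf, hr.lintegral_tilted N n
    (f := fun t => (∫⁻ x, ENNReal.ofReal (G n x) ∂(emp N (t (Fin.last n)))) *
      ∫⁻ c, f (Fin.snoc t c) ∂(nextKernel lam hr N n t))
    ((hr.measurable_lintegral_emp N (n + 1) (hr.measurable_ofReal_G n) (Fin.last n)).mul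
      (hr.measurable_lintegral_nextKernel N n hf)),
    hr.lintegral_particleLaw_succ N n (f := fun t => weight G N (n + 1) t * f t) ((hr.measurable_weight N (n + 1)).mul hf)]
  refine lintegral_congr fun t => ?_
  simp only [weight_snoc]
  rw [lintegral_const_mul, mul_assoc]
  exact hf.comp ((measurable_snoc (n + 1)).comp measurable_prodMk_left)

end IsRegular

end

section

variable {X : Type} [MeasurableSpace X]

lemma lintegral_pi_eval_le (N : ℕ) (hN : N ≠ 0) (ν : Measure X)
    (hν : IsProbabilityMeasure ν ∨ ν = 0) (i : Fin N) {f : X → ℝ≥0∞} (hf : Measurable f) :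
    ∫⁻ c, f (c i) ∂(Measure.pi fun _ : Fin N => ν) ≤ ∫⁻ x, f x ∂ν := by
  rcases hν with hν | rfl
  · exact ((measurePreserving_eval (fun _ : Fin N => ν) i).lintegral_comp hf).le
  · have : (Measure.pi fun _ : Fin N => (0 : Measure X)) = 0 := by
      rw [← Measure.measure_univ_eq_zero, Measure.pi_univ]
      simp [hN]
    simp [this]

lemma lintegral_lintegral_emp_pi_le (N : ℕ) (ν : Measure X)
    (hν : IsProbabilityMeasure ν ∨ ν = 0) {f : X → ℝ≥0∞} (hf : Measurable f) :
    ∫⁻ c, ∫⁻ x, f x ∂(emp N c) ∂(Measure.pi fun _ : Fin N => ν) ≤ ∫⁻ x, f x ∂ν := by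
  rcases eq_or_ne N 0 with rfl | hN
  · simp [emp]
  simp_rw [lintegral_emp N _ hf]
  have hfi : ∀ i, Measurable fun c : Fin N → X => f (c i) := fun i =>
    hf.comp (measurable_pi_apply i)
  rw [lintegral_const_mul _ (Finset.measurable_sum _ fun i _ => hfi i),
    lintegral_finsetSum _ fun i _ => hfi i]
  calc (N : ℝ≥0∞)⁻¹ * ∑ i : Fin N, ∫⁻ c, f (c i) ∂(Measure.pi fun _ : Fin N => ν)
      ≤ (N : ℝ≥0∞)⁻¹ * ∑ _i : Fin N, ∫⁻ x, f x ∂ν := by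
        gcongr with i
        exact lintegral_pi_eval_le N hN ν hν i hf
    _ = ∫⁻ x, f x ∂ν := by
        rw [Finset.sum_const, Finset.card_univ, Fintype.card_fin, nsmul_eq_mul, ← mul_assoc,
          ENNReal.inv_mul_cancel (by simpa) (by simp), one_mul]

/-- Mean absolute error of the empirical mean of a bounded function. -/
lemma lintegral_enorm_emp_sub_le_of_bounded (N : ℕ) (hN : N ≠ 0) (ν : Measure X)
    [IsProbabilityMeasure ν] {f : X → ℝ} (hf : Measurable f) {K : ℝ} (hK : ∀ x, |f x| ≤ K) :
    ∫⁻ c, ‖∫ x, f x ∂(emp N c) - ∫ x, f x ∂ν‖ₑ ∂(Measure.pi fun _ : Fin N => ν) ≤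
      ENNReal.ofReal ((1 + K ^ 2) / √N) := by
  have hL : MemLp f 2 ν := MemLp.of_bound hf.aestronglyMeasurable K (ae_of_all _ hK)
  have hN' : (0 : ℝ) < N := by positivity
  set P := Measure.pi fun _ : Fin N => ν with hP
  set Y : (Fin N → X) → ℝ := fun c => (N : ℝ)⁻¹ * ∑ i, f (c i) with hY
  have hLi : ∀ i : Fin N, MemLp (fun c : Fin N → X => f (c i)) 2 P := fun i =>
    hL.comp_measurePreserving (measurePreserving_eval (fun _ : Fin N => ν) i)
  have hYL : MemLp Y 2 P := (memLp_finsetSum _ fun i _ => hLi i).const_mul _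
  have hEi : ∀ i : Fin N, ∫ c, f (c i) ∂P = ∫ x, f x ∂ν := fun i =>
    integral_comp_eval (μ := fun _ : Fin N => ν) hf.aestronglyMeasurable
  have hEY : ∫ c, Y c ∂P = ∫ x, f x ∂ν := by
    rw [hY, integral_const_mul, integral_finsetSum _ fun i _ => (hLi i).integrable (by norm_num)]
    simp only [hEi, Finset.sum_const, Finset.card_univ, Fintype.card_fin, nsmul_eq_mul]
    field_simp
  have hVf : Var[f; ν] ≤ K ^ 2 := by
    refine (variance_le_expectation_sq hf.aestronglyMeasurable).trans ?_
    have : ∫ x, (f ^ 2) x ∂ν ≤ ∫ _, K ^ 2 ∂ν := by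
      refine integral_mono hL.integrable_sq (integrable_const _) fun x => ?_
      simpa using sq_le_sq' (abs_le.1 (hK x)).1 (abs_le.1 (hK x)).2
    simpa using this
  have hVY : Var[Y; P] ≤ K ^ 2 / N := by
    have h1 : Var[Y; P] = (N : ℝ)⁻¹ ^ 2 * Var[fun c : Fin N → X => ∑ i, f (c i); P] :=
      variance_const_mul _ _ _
    have h2 : Var[∑ i, fun c : Fin N → X => f (c i); P] = ∑ _i : Fin N, Var[f; ν] :=
      variance_sum_pi (X := fun _ => f) fun _ => hL
    have h3 : (∑ i, fun c : Fin N → X => f (c i)) = fun c : Fin N → X => ∑ i, f (c i) := by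
      ext c; simp
    rw [h3] at h2
    rw [h1, h2, Finset.sum_const, Finset.card_univ, Fintype.card_fin, nsmul_eq_mul]
    have : (N : ℝ)⁻¹ ^ 2 * (N * Var[f; ν]) = Var[f; ν] / N := by field_simp
    rw [this]
    gcongr
  have hint : Integrable (fun c => (Y c - ∫ x, f x ∂ν) ^ 2) P :=
    (hYL.sub (memLp_const _)).integrable_sq
  have hVY' : ∫ c, (Y c - ∫ x, f x ∂ν) ^ 2 ∂P ≤ K ^ 2 / N := by
    rw [variance_eq_integral hYL.aestronglyMeasurable.aemeasurable, hEY] at hVY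
    exact hVY
  have hsq : 0 < √(N : ℝ) := Real.sqrt_pos.2 hN'
  have hss : √(N : ℝ) * √(N : ℝ) = N := Real.mul_self_sqrt hN'.le
  simp_rw [integral_emp N _ hf]
  have hi1 : Integrable (fun c => Y c - ∫ x, f x ∂ν) P :=
    (hYL.integrable (by norm_num)).sub (integrable_const _)
  rw [← ofReal_integral_norm_eq_lintegral_enorm hi1]
  refine ENNReal.ofReal_le_ofReal ?_
  calc ∫ c, ‖Y c - ∫ x, f x ∂ν‖ ∂P
      ≤ ∫ c, (1 / √N + √N * (Y c - ∫ x, f x ∂ν) ^ 2) ∂P := by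
        refine integral_mono hi1.norm ((integrable_const _).add (hint.const_mul _)) fun c => ?_
        simp only [Real.norm_eq_abs]
        set z := Y c - ∫ x, f x ∂ν
        have hz : z ^ 2 = |z| ^ 2 := (sq_abs z).symm
        rw [hz, div_add' _ _ _ hsq.ne', le_div_iff₀ hsq]
        nlinarith [sq_nonneg (√(N : ℝ) * |z| - 1), sq_nonneg (√(N : ℝ) * |z|)]
    _ = 1 / √N + √N * ∫ c, (Y c - ∫ x, f x ∂ν) ^ 2 ∂P := by
        rw [integral_add (integrable_const _) (hint.const_mul _), integral_const_mul]
        simp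
    _ ≤ 1 / √N + √N * (K ^ 2 / N) := by gcongr
    _ = (1 + K ^ 2) / √N := by
        have h : √N * (K ^ 2 / N) = K ^ 2 / √N := by
          rw [mul_div_assoc', div_eq_div_iff hN'.ne' hsq.ne']
          linear_combination K ^ 2 * hss
        rw [h, ← add_div]

/-- Mean absolute error of the empirical mean of an arbitrary function, after truncation. -/
lemma lintegral_enorm_emp_sub_le (N : ℕ) (hN : N ≠ 0) (ν : Measure X)
    (hν : IsProbabilityMeasure ν ∨ ν = 0) {f : X → ℝ} (hf : Measurable f) {K : ℝ} (hK : 0 ≤ K) :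
    ∫⁻ c, ‖∫ x, f x ∂(emp N c) - ∫ x, f x ∂ν‖ₑ ∂(Measure.pi fun _ : Fin N => ν) ≤
      ENNReal.ofReal ((1 + K ^ 2) / √N) +
        2 * ∫⁻ x, {x | K < |f x|}.indicator (fun x => ‖f x‖ₑ) x ∂ν := by
  rcases hν with hν | rfl
  swap
  · have : (Measure.pi fun _ : Fin N => (0 : Measure X)) = 0 := by
      rw [← Measure.measure_univ_eq_zero, Measure.pi_univ]
      simp [hN]
    simp [this]
  have hS : MeasurableSet {x | K < |f x|} := measurableSet_lt measurable_const hf.abs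
  set f1 : X → ℝ := {x | K < |f x|}ᶜ.indicator f with hf1
  set f2 : X → ℝ := {x | K < |f x|}.indicator f with hf2
  have hf1m : Measurable f1 := hf.indicator hS.compl
  have hf2m : Measurable f2 := hf.indicator hS
  have hsum : ∀ x, f x = f1 x + f2 x := fun x => by
    have := Set.indicator_compl_add_self_apply {x | K < |f x|} f x
    exact this.symm
  have hb : ∀ x, |f1 x| ≤ K := by
    intro x
    by_cases h : K < |f x|
    · simp [hf1, h, hK]
    · simpa [hf1, h] using not_lt.1 h
  have he : ∀ x, {x | K < |f x|}.indicator (fun x => ‖f x‖ₑ) x = ‖f2 x‖ₑ := by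
    intro x
    by_cases h : K < |f x| <;> simp [hf2, h]
  simp_rw [he]
  by_cases htop : ∫⁻ x, ‖f2 x‖ₑ ∂ν = ∞
  · simp [htop]
  have hi1 : Integrable f1 ν := Integrable.of_bound hf1m.aestronglyMeasurable K (ae_of_all _ hb)
  have hi2 : Integrable f2 ν := ⟨hf2m.aestronglyMeasurable, lt_top_iff_ne_top.2 htop⟩
  have hfe : f = fun x => f1 x + f2 x := funext hsum
  have hpt : ∀ c : Fin N → X, ‖∫ x, f x ∂(emp N c) - ∫ x, f x ∂ν‖ₑ ≤
      ‖∫ x, f1 x ∂(emp N c) - ∫ x, f1 x ∂ν‖ₑ +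
        (∫⁻ x, ‖f2 x‖ₑ ∂(emp N c) + ∫⁻ x, ‖f2 x‖ₑ ∂ν) := by
    intro c
    rw [hfe, integral_add (integrable_emp N c hf1m) (integrable_emp N c hf2m),
      integral_add hi1 hi2, add_sub_add_comm]
    refine (enorm_add_le _ _).trans (add_le_add le_rfl ?_)
    exact enorm_sub_le.trans
      (add_le_add (enorm_integral_le_lintegral_enorm _) (enorm_integral_le_lintegral_enorm _))
  have hm1 : Measurable fun c : Fin N → X => ‖∫ x, f1 x ∂(emp N c) - ∫ x, f1 x ∂ν‖ₑ := by
    simp_rw [integral_emp N _ hf1m]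
    refine Measurable.enorm (Measurable.sub_const (Measurable.const_mul ?_ _) _)
    exact Finset.measurable_sum _ fun i _ => hf1m.comp (measurable_pi_apply i)
  calc _ ≤ ∫⁻ c, (‖∫ x, f1 x ∂(emp N c) - ∫ x, f1 x ∂ν‖ₑ +
        (∫⁻ x, ‖f2 x‖ₑ ∂(emp N c) + ∫⁻ x, ‖f2 x‖ₑ ∂ν)) ∂(Measure.pi fun _ : Fin N => ν) :=
        lintegral_mono hpt
    _ = ∫⁻ c, ‖∫ x, f1 x ∂(emp N c) - ∫ x, f1 x ∂ν‖ₑ ∂(Measure.pi fun _ : Fin N => ν) +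
        (∫⁻ c, ∫⁻ x, ‖f2 x‖ₑ ∂(emp N c) ∂(Measure.pi fun _ : Fin N => ν) +
          ∫⁻ x, ‖f2 x‖ₑ ∂ν) := by
        rw [lintegral_add_left hm1, lintegral_add_right _ measurable_const]
        simp
    _ ≤ ENNReal.ofReal ((1 + K ^ 2) / √N) + (∫⁻ x, ‖f2 x‖ₑ ∂ν + ∫⁻ x, ‖f2 x‖ₑ ∂ν) := by
        gcongr
        · exact lintegral_enorm_emp_sub_le_of_bounded N hN ν hf1m hb
        · exact lintegral_lintegral_emp_pi_le N ν (Or.inl hν) hf2m.enorm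
    _ = _ := by rw [two_mul]

end

section

variable {X : Type} [MeasurableSpace X]

/-- The empirical measure of the particles at a given time, as a kernel from trajectories. -/
def empKernel (X : Type) [MeasurableSpace X] (N n : ℕ) (k : Fin n) :
    Kernel (Fin n → Fin N → X) X where
  toFun t := emp N (t k)
  measurable' := (measurable_emp N).comp (measurable_pi_apply k)

lemma empKernel_apply (N n : ℕ) (k : Fin n) (t : Fin n → Fin N → X) :
    empKernel X N n k t = emp N (t k) := rfl

instance (N n : ℕ) (k : Fin n) : IsFiniteKernel (empKernel X N n k) :=
  ⟨1, one_lt_top, fun t => emp_univ_le_one N (t k)⟩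

lemma measurable_init {Y : Type*} [MeasurableSpace Y] (n : ℕ) :
    Measurable fun t : Fin (n + 1) → Y => (Fin.init t : Fin n → Y) :=
  measurable_pi_iff.2 fun i => measurable_pi_apply i.castSucc

lemma tendsto_zero_of_forall_le {u C : ℕ → ℝ≥0∞} {A : ℕ → ℕ → ℝ≥0∞} {B : ℕ → ℝ≥0∞}
    (hu : ∀ K, ∀ᶠ N in atTop, u N ≤ A K N + B K + C N)
    (hA : ∀ K, Tendsto (A K) atTop (𝓝 0)) (hB : Tendsto B atTop (𝓝 0))
    (hC : Tendsto C atTop (𝓝 0)) : Tendsto u atTop (𝓝 0) := by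
  rw [ENNReal.tendsto_nhds_zero] at *
  intro ε hε
  have hε3 : 0 < ε / 3 := ENNReal.div_pos hε.ne' (by simp)
  obtain ⟨K, hK⟩ := (hB _ hε3).exists
  filter_upwards [hu K, (ENNReal.tendsto_nhds_zero.1 (hA K)) _ hε3, hC _ hε3] with N h1 h2 h3
  calc u N ≤ A K N + B K + C N := h1
    _ ≤ ε / 3 + ε / 3 + ε / 3 := by gcongr
    _ = ε := ENNReal.add_thirds ε

lemma tendsto_ofReal_div_sqrt_mul (a : ℝ) {D : ℝ≥0∞} (hD : D ≠ ∞) :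
    Tendsto (fun N : ℕ => ENNReal.ofReal (a / √(N : ℝ)) * D) atTop (𝓝 0) := by
  have h1 : Tendsto (fun N : ℕ => a / √(N : ℝ)) atTop (𝓝 0) :=
    tendsto_const_nhds.div_atTop (Real.tendsto_sqrt_atTop.comp tendsto_natCast_atTop_atTop)
  have h2 := ENNReal.Tendsto.mul_const (b := D) (ENNReal.tendsto_ofReal h1) (Or.inr hD)
  simpa using h2

lemma tendsto_lintegral_tail {ν : Measure X} {f : X → ℝ} (hf : Measurable f)
    (hi : Integrable f ν) :
    Tendsto (fun K : ℕ => 2 * ∫⁻ x, {x | (K : ℝ) < |f x|}.indicator (fun x => ‖f x‖ₑ) x ∂ν)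
      atTop (𝓝 0) := by
  have h : Tendsto (fun K : ℕ => ∫⁻ x, {x | (K : ℝ) < |f x|}.indicator (fun x => ‖f x‖ₑ) x ∂ν)
      atTop (𝓝 (∫⁻ _, 0 ∂ν)) := by
    refine tendsto_lintegral_of_dominated_convergence (fun x => ‖f x‖ₑ) (fun K => ?_)
      (fun K => ?_) hi.2.ne (ae_of_all _ fun x => ?_)
    · exact hf.enorm.indicator (measurableSet_lt measurable_const hf.abs)
    · exact ae_of_all _ fun x => Set.indicator_le_self _ _ _
    · refine tendsto_const_nhds.congr' ?_
      obtain ⟨K0, hK0⟩ := exists_nat_ge |f x|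
      filter_upwards [eventually_ge_atTop K0] with K hK
      have : |f x| ≤ K := hK0.trans (by exact_mod_cast hK)
      simp [this]
  simp only [lintegral_zero] at h
  simpa using ENNReal.Tendsto.const_mul (a := 2) h (Or.inr (by simp))

variable {lam mu : Measure X} [SigmaFinite lam] [IsProbabilityMeasure mu]
  {G : ℕ → X → ℝ} {H : ℕ → X → X → ℝ}

namespace IsRegular

variable (hr : IsRegular lam G H)
include hr

lemma PhiMeas_prob_or_zero (n : ℕ) (ν : Measure X) [IsFiniteMeasure ν] :
    IsProbabilityMeasure (PhiMeas lam G H (n + 1) ν) ∨ PhiMeas lam G H (n + 1) ν = 0 := by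
  by_cases h : ∫⁻ x, ENNReal.ofReal (G n x) ∂ν = 0
  · exact Or.inr (hr.PhiMeas_eq_zero n ν h)
  · exact Or.inl (hr.isProbabilityMeasure_PhiMeas n ν h)

/-- One step of the particle system does not increase, on average, the integral of nonnegative
functions that may depend on the past of the trajectory. -/
lemma lintegral_tilted_succ_emp_le (N n : ℕ) {g : (Fin (n + 1) → Fin N → X) → X → ℝ≥0∞}
    (hg : Measurable (Function.uncurry g)) :
    ∫⁻ t, ∫⁻ x, g (Fin.init t) x ∂(emp N (t (Fin.last (n + 1))))
        ∂(tilted lam mu G H N (n + 1)) ≤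
      ∫⁻ t, ∫⁻ y, g t y ∂(stepM lam G H n (emp N (t (Fin.last n))))
        ∂(tilted lam mu G H N n) := by
  have hm : Measurable fun t : Fin (n + 2) → Fin N → X =>
      ∫⁻ x, g (Fin.init t) x ∂(emp N (t (Fin.last (n + 1)))) :=
    Measurable.lintegral_kernel_prod_right' (κ := empKernel X N (n + 2) (Fin.last (n + 1)))
      (f := fun z => g (Fin.init z.1) z.2)
      (hg.comp (((measurable_init (n + 1)).comp measurable_fst).prodMk measurable_snd))
  rw [hr.lintegral_tilted_succ N n hm]
  refine lintegral_mono fun t => ?_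
  simp only [Fin.init_snoc, Fin.snoc_last]
  have hgt : Measurable (g t) := hg.comp measurable_prodMk_left
  refine le_trans ?_ (hr.mul_PhiMeas_le n _ _)
  gcongr
  exact lintegral_lintegral_emp_pi_le N _ (hr.PhiMeas_prob_or_zero n _) hgt

lemma lintegral_tilted_emp_le (N n : ℕ) {f : X → ℝ≥0∞} (hf : Measurable f) :
    ∫⁻ t, ∫⁻ x, f x ∂(emp N (t (Fin.last n))) ∂(tilted lam mu G H N n) ≤
      ∫⁻ x, f x ∂(gammaM lam mu G H n) := by
  induction n generalizing f with
  | zero =>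
    rw [hr.lintegral_tilted_zero N (hr.measurable_lintegral_emp N 1 hf (Fin.last 0))]
    exact lintegral_lintegral_emp_pi_le N mu (Or.inl inferInstance) hf
  | succ n ih =>
    refine (hr.lintegral_tilted_succ_emp_le N n (g := fun _ => f)
      (hf.comp measurable_snd)).trans ?_
    simp_rw [hr.lintegral_stepM_eq_mutation n _ hf]
    refine (ih ((hr.measurable_ofReal_G n).mul
      ((Measure.measurable_lintegral hf).comp (mutation lam hr (n + 1)).measurable))).trans ?_
    exact (hr.lintegral_stepM_eq_mutation n (gammaM lam mu G H n) hf).ge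

lemma tilted_univ_le (N n : ℕ) (hN : N ≠ 0) :
    tilted lam mu G H N n Set.univ ≤ gammaM lam mu G H n Set.univ := by
  have h := hr.lintegral_tilted_emp_le (mu := mu) N n (f := fun _ => 1) measurable_const
  have h1 : ∀ t : Fin (n + 1) → Fin N → X, emp N (t (Fin.last n)) Set.univ = 1 := fun t =>
    (isProbabilityMeasure_emp N hN _).measure_univ
  simpa [h1] using h

lemma lintegral_tilted_stepM_le (N n : ℕ) {f : X → ℝ≥0∞} (hf : Measurable f) :
    ∫⁻ t, ∫⁻ x, f x ∂(stepM lam G H n (emp N (t (Fin.last n)))) ∂(tilted lam mu G H N n) ≤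
      ∫⁻ x, f x ∂(gammaM lam mu G H (n + 1)) := by
  simp_rw [hr.lintegral_stepM_eq_mutation n _ hf]
  refine (hr.lintegral_tilted_emp_le N n ((hr.measurable_ofReal_G n).mul
    ((Measure.measurable_lintegral hf).comp (mutation lam hr (n + 1)).measurable))).trans ?_
  exact (hr.lintegral_stepM_eq_mutation n (gammaM lam mu G H n) hf).ge

lemma measurable_lintegral_stepM_emp (N n : ℕ) {f : X → ℝ≥0∞} (hf : Measurable f) :
    Measurable fun t : Fin (n + 1) → Fin N → X =>
      ∫⁻ x, f x ∂(stepM lam G H n (emp N (t (Fin.last n)))) :=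
  (Measure.measurable_lintegral hf).comp ((hr.measurable_stepM n).comp
    ((measurable_emp N).comp (measurable_pi_apply (Fin.last n))))

omit hr in
lemma measurable_integral_emp (N n : ℕ) {f : X → ℝ} (hf : Measurable f) (k : Fin n) :
    Measurable fun t : Fin n → Fin N → X => ∫ x, f x ∂(emp N (t k)) := by
  simp_rw [integral_emp N _ hf]
  refine Measurable.const_mul (Finset.measurable_sum _ fun i _ => ?_) _
  exact hf.comp ((measurable_pi_apply i).comp (measurable_pi_apply k))

lemma lintegral_tilted_succ_enorm_emp_le (N n : ℕ) (hN : N ≠ 0) {f : X → ℝ}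
    (hf : Measurable f) (hi : Integrable f (gammaM lam mu G H (n + 1))) {K : ℝ} (hK : 0 ≤ K) :
    ∫⁻ t, ‖∫ x, f x ∂(emp N (t (Fin.last (n + 1))))‖ₑ ∂(tilted lam mu G H N (n + 1)) ≤
      ENNReal.ofReal ((1 + K ^ 2) / √N) *
          ∫⁻ x, ENNReal.ofReal (G n x) ∂(gammaM lam mu G H n) +
        2 * ∫⁻ x, {x | K < |f x|}.indicator (fun x => ‖f x‖ₑ) x ∂(gammaM lam mu G H (n + 1)) +
        ∫⁻ t, ‖∫ x, G n x * ∫ y, f y ∂(mutation lam hr (n + 1) x) ∂(emp N (t (Fin.last n)))‖ₑ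
          ∂(tilted lam mu G H N n) := by
  set R := ENNReal.ofReal ((1 + K ^ 2) / √N)
  set tail : X → ℝ≥0∞ := fun x => {x | K < |f x|}.indicator (fun x => ‖f x‖ₑ) x with htail
  have htm : Measurable tail :=
    hf.enorm.indicator (measurableSet_lt measurable_const hf.abs)
  have hGm := hr.measurable_lintegral_emp N (n + 1) (hr.measurable_ofReal_G n) (Fin.last n)
  rw [hr.lintegral_tilted_succ N n
    (f := fun t => ‖∫ x, f x ∂(emp N (t (Fin.last (n + 1))))‖ₑ)
    (measurable_integral_emp N (n + 2) hf (Fin.last (n + 1))).enorm]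
  have hfin : ∀ᵐ t ∂(tilted lam mu G H N n),
      ∫⁻ x, ‖f x‖ₑ ∂(stepM lam G H n (emp N (t (Fin.last n)))) < ∞ :=
    ae_lt_top (hr.measurable_lintegral_stepM_emp N n hf.enorm)
      ((hr.lintegral_tilted_stepM_le N n hf.enorm).trans_lt hi.2).ne
  have hpt : ∀ᵐ t ∂(tilted lam mu G H N n),
      (∫⁻ x, ENNReal.ofReal (G n x) ∂(emp N (t (Fin.last n)))) *
        ∫⁻ c, ‖∫ x, f x ∂(emp N ((Fin.snoc t c : Fin (n + 2) → Fin N → X)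
          (Fin.last (n + 1))))‖ₑ ∂(nextKernel lam hr N n t) ≤
      (R * ∫⁻ x, ENNReal.ofReal (G n x) ∂(emp N (t (Fin.last n))) +
        2 * ∫⁻ x, tail x ∂(stepM lam G H n (emp N (t (Fin.last n))))) +
      ‖∫ x, G n x * ∫ y, f y ∂(mutation lam hr (n + 1) x) ∂(emp N (t (Fin.last n)))‖ₑ := by
    filter_upwards [hfin] with t ht
    simp only [Fin.snoc_last]
    set ν := emp N (t (Fin.last n))
    set a := ∫⁻ x, ENNReal.ofReal (G n x) ∂ν
    have hfi : Integrable f (stepM lam G H n ν) := ⟨hf.aestronglyMeasurable, ht⟩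
    rw [← (hr.integral_stepM n ν hfi).2]
    set Φ := PhiMeas lam G H (n + 1) ν
    have h1 : ∫⁻ c, ‖∫ x, f x ∂(emp N c)‖ₑ ∂(nextKernel lam hr N n t) ≤
        R + 2 * ∫⁻ x, tail x ∂Φ + ‖∫ x, f x ∂Φ‖ₑ := by
      calc ∫⁻ c, ‖∫ x, f x ∂(emp N c)‖ₑ ∂(nextKernel lam hr N n t)
          ≤ ∫⁻ c, (‖∫ x, f x ∂(emp N c) - ∫ x, f x ∂Φ‖ₑ + ‖∫ x, f x ∂Φ‖ₑ)
              ∂(nextKernel lam hr N n t) := by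
            refine lintegral_mono fun c => ?_
            simpa using enorm_add_le (∫ x, f x ∂(emp N c) - ∫ x, f x ∂Φ) (∫ x, f x ∂Φ)
        _ = ∫⁻ c, ‖∫ x, f x ∂(emp N c) - ∫ x, f x ∂Φ‖ₑ ∂(nextKernel lam hr N n t) +
              ‖∫ x, f x ∂Φ‖ₑ * nextKernel lam hr N n t Set.univ := by
            rw [lintegral_add_right _ measurable_const, lintegral_const]
        _ ≤ _ := by
            gcongr
            · exact lintegral_enorm_emp_sub_le N hN Φ (hr.PhiMeas_prob_or_zero n ν) hf hK
            · exact mul_le_of_le_one_right' (hr.nextKernel_univ_le_one N n t)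
    calc a * ∫⁻ c, ‖∫ x, f x ∂(emp N c)‖ₑ ∂(nextKernel lam hr N n t)
        ≤ a * (R + 2 * ∫⁻ x, tail x ∂Φ + ‖∫ x, f x ∂Φ‖ₑ) := by gcongr
      _ = R * a + 2 * (a * ∫⁻ x, tail x ∂Φ) + a * ‖∫ x, f x ∂Φ‖ₑ := by ring
      _ ≤ _ := by
          gcongr
          · exact hr.mul_PhiMeas_le n ν tail
          · exact hr.mul_enorm_integral_PhiMeas_le n ν f
  refine (lintegral_mono_ae hpt).trans ?_
  have hsm := hr.measurable_lintegral_stepM_emp N n htm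
  have hm1 : Measurable fun t : Fin (n + 1) → Fin N → X =>
      R * ∫⁻ x, ENNReal.ofReal (G n x) ∂(emp N (t (Fin.last n))) +
        2 * ∫⁻ x, tail x ∂(stepM lam G H n (emp N (t (Fin.last n)))) :=
    (hGm.const_mul R).add (hsm.const_mul 2)
  rw [lintegral_add_left hm1,
    lintegral_add_left (hGm.const_mul R), lintegral_const_mul _ hGm, lintegral_const_mul _ hsm]
  gcongr
  · exact hr.lintegral_tilted_emp_le N n (hr.measurable_ofReal_G n)
  · exact hr.lintegral_tilted_stepM_le N n htm

/-- Law of large numbers in weighted mean for integrable centred functions. -/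
lemma tendsto_lintegral_enorm_emp_of_integral_eq_zero (n : ℕ) {f : X → ℝ} (hf : Measurable f)
    (hi : Integrable f (gammaM lam mu G H n)) (h0 : ∫ x, f x ∂(gammaM lam mu G H n) = 0) :
    Tendsto (fun N : ℕ => ∫⁻ t, ‖∫ x, f x ∂(emp N (t (Fin.last n)))‖ₑ
      ∂(tilted lam mu G H N n)) atTop (𝓝 0) := by
  induction n generalizing f with
  | zero =>
    refine tendsto_zero_of_forall_le (C := fun _ => 0) (fun K => ?_)
      (fun K => tendsto_ofReal_div_sqrt_mul (1 + (K : ℝ) ^ 2) one_ne_top)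
      (tendsto_lintegral_tail hf hi) tendsto_const_nhds
    filter_upwards [eventually_ne_atTop 0] with N hN
    rw [hr.lintegral_tilted_zero N
      (f := fun t => ‖∫ x, f x ∂(emp N (t (Fin.last 0)))‖ₑ)
      (measurable_integral_emp N 1 hf (Fin.last 0)).enorm]
    have h := lintegral_enorm_emp_sub_le N hN mu (Or.inl inferInstance) hf
      (K := (K : ℝ)) (Nat.cast_nonneg K)
    simp only [gammaM] at h0
    simpa [h0, gammaM] using h
  | succ n ih =>
    have hfin := hr.isFiniteMeasure_gammaM (mu := mu) n
    obtain ⟨h1, h2⟩ := hr.integral_stepM n (gammaM lam mu G H n) hi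
    have h3 := ih (hr.measurable_G_mul_integral n hf) h1 (h2.symm.trans h0)
    refine tendsto_zero_of_forall_le (fun K => ?_)
      (fun K => tendsto_ofReal_div_sqrt_mul (1 + (K : ℝ) ^ 2)
        (hr.lintegral_G_lt_top n (gammaM lam mu G H n)).ne)
      (tendsto_lintegral_tail hf hi) h3
    filter_upwards [eventually_ne_atTop 0] with N hN
    exact hr.lintegral_tilted_succ_enorm_emp_le N n hN hf hi (Nat.cast_nonneg K)

omit hr in
lemma integral_eta (n : ℕ) (f : X → ℝ) :
    ∫ x, f x ∂(eta lam mu G H n) =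
      ((gammaM lam mu G H n Set.univ)⁻¹).toReal * ∫ x, f x ∂(gammaM lam mu G H n) := by
  rw [eta, integral_smul_measure, smul_eq_mul]

/-- Law of large numbers in weighted mean for integrable functions. -/
lemma tendsto_lintegral_enorm_emp_sub (n : ℕ) {f : X → ℝ} (hf : Measurable f)
    (hi : Integrable f (gammaM lam mu G H n)) :
    Tendsto (fun N : ℕ => ∫⁻ t, ‖∫ x, f x ∂(emp N (t (Fin.last n))) -
      ∫ x, f x ∂(eta lam mu G H n)‖ₑ ∂(tilted lam mu G H N n)) atTop (𝓝 0) := by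
  have hfin := hr.isFiniteMeasure_gammaM (mu := mu) n
  by_cases hg : gammaM lam mu G H n Set.univ = 0
  · refine tendsto_const_nhds.congr' ?_
    filter_upwards [eventually_ne_atTop 0] with N hN
    have h1 : tilted lam mu G H N n = 0 := by
      rw [← Measure.measure_univ_eq_zero]
      exact le_antisymm ((hr.tilted_univ_le N n hN).trans hg.le) zero_le
    simp [h1]
  · set c := ∫ x, f x ∂(eta lam mu G H n) with hc
    have h0 : ∫ x, (f x - c) ∂(gammaM lam mu G H n) = 0 := by
      rw [integral_sub hi (integrable_const _), integral_const, hc, integral_eta,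
        ENNReal.toReal_inv, Measure.real, smul_eq_mul, ← mul_assoc, mul_inv_cancel₀, one_mul,
        sub_self]
      exact ENNReal.toReal_ne_zero.2 ⟨hg, measure_ne_top _ _⟩
    have h := hr.tendsto_lintegral_enorm_emp_of_integral_eq_zero n (hf.sub_const c)
      (hi.sub (integrable_const _)) h0
    refine h.congr' ?_
    filter_upwards [eventually_ne_atTop 0] with N hN
    refine lintegral_congr fun t => ?_
    have := isProbabilityMeasure_emp N hN (t (Fin.last n))
    rw [integral_sub (integrable_emp N _ hf) (integrable_const _)]
    simp

end IsRegular

end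

section

variable {X : Type} [MeasurableSpace X]

variable {lam mu : Measure X} [SigmaFinite lam] [IsProbabilityMeasure mu]
  {G : ℕ → X → ℝ} {H : ℕ → X → X → ℝ}

namespace IsRegular

variable (hr : IsRegular lam G H)
include hr

lemma integrable_G (n : ℕ) (ν : Measure X) [IsFiniteMeasure ν] : Integrable (G n) ν := by
  refine ⟨(hr.measurable_G n).aestronglyMeasurable, ?_⟩
  refine (lintegral_congr fun x => ?_).trans_lt (hr.lintegral_G_lt_top n ν)
  rw [Real.enorm_eq_ofReal (hr.G_nonneg n x)]

lemma ofReal_integral_G (n : ℕ) (ν : Measure X) [IsFiniteMeasure ν] :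
    ENNReal.ofReal (∫ x, G n x ∂ν) = ∫⁻ x, ENNReal.ofReal (G n x) ∂ν :=
  ofReal_integral_eq_lintegral_ofReal (hr.integrable_G n ν) (ae_of_all _ (hr.G_nonneg n))

lemma nextKernel_eq_zero (N n : ℕ) (hN : N ≠ 0) (t : Fin (n + 1) → Fin N → X)
    (h : ∫⁻ x, ENNReal.ofReal (G n x) ∂(emp N (t (Fin.last n))) = 0) :
    nextKernel lam hr N n t = 0 := by
  have := hr.isFiniteMeasure_PhiMeas n (emp N (t (Fin.last n)))
  rw [← Measure.measure_univ_eq_zero, nextKernel_apply, Measure.pi_univ,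
    hr.PhiMeas_eq_zero n _ h]
  simp [hN]

lemma isFiniteMeasure_tilted (N n : ℕ) (hN : N ≠ 0) :
    IsFiniteMeasure (tilted lam mu G H N n) :=
  have := hr.isFiniteMeasure_gammaM (mu := mu) n
  ⟨(hr.tilted_univ_le N n hN).trans_lt (measure_lt_top _ _)⟩

/-- Convergence to zero in weighted mean of bounded functions implies convergence to zero in
mean. -/
lemma tendsto_lintegral_particleLaw (n : ℕ) {f : (N : ℕ) → (Fin (n + 1) → Fin N → X) → ℝ≥0∞}
    (hf : ∀ N, Measurable (f N)) (h1 : ∀ N t, f N t ≤ 1)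
    (h : Tendsto (fun N => ∫⁻ t, f N t ∂(tilted lam mu G H N n)) atTop (𝓝 0)) :
    Tendsto (fun N => ∫⁻ t, f N t ∂(particleLaw lam mu G H N n)) atTop (𝓝 0) := by
  induction n with
  | zero =>
    refine h.congr fun N => ?_
    rw [hr.lintegral_tilted N 0 (hf N)]
    simp [weight]
  | succ n ih =>
    have hfin := hr.isFiniteMeasure_gammaM (mu := mu) n
    have hKm := fun N => hr.measurable_lintegral_nextKernel N n (hf N)
    simp_rw [fun N => hr.lintegral_particleLaw_succ (mu := mu) N n (hf N)]
    refine ih (f := fun N t => ∫⁻ c, f N (Fin.snoc t c) ∂(nextKernel lam hr N n t)) hKm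
      (fun N t => ?_) ?_
    · calc ∫⁻ c, f N (Fin.snoc t c) ∂(nextKernel lam hr N n t)
          ≤ ∫⁻ _, 1 ∂(nextKernel lam hr N n t) := lintegral_mono fun c => h1 N _
        _ ≤ 1 := by simpa using hr.nextKernel_univ_le_one N n t
    · by_cases h0 : ∫⁻ x, ENNReal.ofReal (G n x) ∂(gammaM lam mu G H n) = 0
      · refine tendsto_const_nhds.congr' ?_
        filter_upwards [eventually_ne_atTop 0] with N hN
        have hz := le_antisymm ((hr.lintegral_tilted_emp_le N n
          (hr.measurable_ofReal_G n)).trans h0.le) zero_le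
        rw [lintegral_eq_zero_iff (hr.measurable_lintegral_emp N (n + 1)
          (hr.measurable_ofReal_G n) (Fin.last n))] at hz
        symm
        rw [lintegral_eq_zero_iff (hKm N)]
        filter_upwards [hz] with t ht
        simp [hr.nextKernel_eq_zero N n hN t ht]
      · have hgi := hr.integrable_G n (gammaM lam mu G H n)
        set m := ∫ x, G n x ∂(eta lam mu G H n) with hm
        have hg0 : gammaM lam mu G H n Set.univ ≠ 0 := by
          intro h2
          rw [Measure.measure_univ_eq_zero] at h2
          simp [h2] at h0
        have hmpos : 0 < m := by
          rw [hm, integral_eta]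
          refine mul_pos (ENNReal.toReal_pos (by simp) (by simp [hg0])) ?_
          rw [← hr.ofReal_integral_G n] at h0
          exact ENNReal.ofReal_pos.1 (pos_iff_ne_zero.2 h0)
        have hmE : ENNReal.ofReal m ≠ 0 := (ENNReal.ofReal_pos.2 hmpos).ne'
        have hL := hr.tendsto_lintegral_enorm_emp_sub n (hr.measurable_G n) hgi
        have hsum := ENNReal.Tendsto.const_mul (a := (ENNReal.ofReal m)⁻¹) (hL.add h)
          (Or.inr (by simp [hmpos]))
        simp only [add_zero, mul_zero] at hsum
        refine tendsto_of_tendsto_of_tendsto_of_le_of_le tendsto_const_nhds hsum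
          (fun _ => zero_le) fun N => ?_
        simp only
        rw [hr.lintegral_tilted_succ N n (hf N), ← lintegral_add_left, ← lintegral_const_mul]
        · refine lintegral_mono fun t => ?_
          set K := ∫⁻ c, f N (Fin.snoc t c) ∂(nextKernel lam hr N n t)
          have hK1 : K ≤ 1 := by
            calc K ≤ ∫⁻ _, 1 ∂(nextKernel lam hr N n t) := lintegral_mono fun c => h1 N _
              _ ≤ 1 := by simpa using hr.nextKernel_univ_le_one N n t
          rw [← hr.ofReal_integral_G n]
          set I := ∫ x, G n x ∂(emp N (t (Fin.last n)))
          have hmI : ENNReal.ofReal m ≤ ‖I - m‖ₑ + ENNReal.ofReal I := by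
            rw [Real.enorm_eq_ofReal_abs]
            refine le_trans (ENNReal.ofReal_le_ofReal ?_) ENNReal.ofReal_add_le
            linarith [neg_abs_le (I - m)]
          rw [mul_comm, ← div_eq_mul_inv, ENNReal.le_div_iff_mul_le (Or.inl hmE)
            (Or.inl ofReal_ne_top)]
          calc K * ENNReal.ofReal m ≤ K * (‖I - m‖ₑ + ENNReal.ofReal I) := by gcongr
            _ = K * ‖I - m‖ₑ + ENNReal.ofReal I * K := by ring
            _ ≤ ‖I - m‖ₑ + ENNReal.ofReal I * K := by
                gcongr
                exact mul_le_of_le_one_left' hK1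
        · exact ((measurable_integral_emp N (n + 1) (hr.measurable_G n)
            (Fin.last n)).sub_const m).enorm.add
            ((hr.measurable_lintegral_emp N (n + 1) (hr.measurable_ofReal_G n)
              (Fin.last n)).mul (hKm N))
        · exact ((measurable_integral_emp N (n + 1) (hr.measurable_G n)
            (Fin.last n)).sub_const m).enorm

/-- The law of the particle system up to time `n` dominates the marginal of its extension. -/
lemma lintegral_particleLaw_init_le (N n : ℕ) {f : (Fin (n + 1) → Fin N → X) → ℝ≥0∞}
    (hf : Measurable f) :
    ∫⁻ t, f (Fin.init t) ∂(particleLaw lam mu G H N (n + 1)) ≤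
      ∫⁻ t, f t ∂(particleLaw lam mu G H N n) := by
  rw [hr.lintegral_particleLaw_succ N n (f := fun t => f (Fin.init t))
    (hf.comp (measurable_init (n + 1)))]
  refine lintegral_mono fun t => ?_
  simp only [Fin.init_snoc, lintegral_const]
  exact mul_le_of_le_one_right' (hr.nextKernel_univ_le_one N n t)

end IsRegular

end

section

variable {X : Type} [MeasurableSpace X]

/-- The empirical measures of a trajectory, as kernels. -/
def empSeqKernel (X : Type) [MeasurableSpace X] (N n k : ℕ) :
    Kernel (Fin (n + 1) → Fin N → X) X :=
  if h : k < n + 1 then empKernel X N (n + 1) ⟨k, h⟩ else 0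

lemma empSeqKernel_apply (N n k : ℕ) (t : Fin (n + 1) → Fin N → X) :
    empSeqKernel X N n k t = empSeq N n t k := by
  by_cases h : k < n + 1 <;> simp [empSeqKernel, empSeq, h, empKernel_apply]

instance (N n k : ℕ) : IsFiniteKernel (empSeqKernel X N n k) := by
  by_cases h : k < n + 1 <;> simp only [empSeqKernel, h, dite_true, dite_false] <;> infer_instance

lemma empSeq_self (N n : ℕ) (t : Fin (n + 1) → Fin N → X) :
    empSeq N n t n = emp N (t (Fin.last n)) := by
  simp [empSeq, Fin.last]

lemma empSeq_init (N n k : ℕ) (hk : k < n + 1) (t : Fin (n + 2) → Fin N → X) :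
    empSeq N (n + 1) t k = empSeq N n (Fin.init t) k := by
  simp [empSeq, hk, Nat.lt_succ_of_lt hk, Fin.init]

lemma Bpath_congr (G : ℕ → X → ℝ) (H : ℕ → X → X → ℝ) {e e' : ℕ → Measure X} (p : ℕ)
    (h : ∀ k < p, e k = e' k) (x : X) (F : (Fin p → X) → ℝ) :
    Bpath G H e p x F = Bpath G H e' p x F := by
  induction p generalizing x with
  | zero => rfl
  | succ p ih =>
    simp only [Bpath, h p p.lt_succ_self, ih fun k hk => h k (hk.trans p.lt_succ_self)]

variable {lam mu : Measure X} [SigmaFinite lam] [IsProbabilityMeasure mu]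
  {G : ℕ → X → ℝ} {H : ℕ → X → X → ℝ}

namespace IsRegular

variable (hr : IsRegular lam G H)
include hr

lemma isFiniteMeasure_eta (n : ℕ) : IsFiniteMeasure (eta lam mu G H n) := by
  have := hr.isFiniteMeasure_gammaM (mu := mu) n
  refine ⟨?_⟩
  simp only [eta, Measure.smul_apply, smul_eq_mul]
  exact (ENNReal.inv_mul_le_one _).trans_lt one_lt_top

lemma measurable_backWeight (p : ℕ) (x : X) : Measurable fun y => G p y * H (p + 1) y x :=
  (hr.measurable_G p).mul (hr.measurable_H_left (p + 1) x)

lemma backWeight_nonneg (p : ℕ) (x y : X) : 0 ≤ G p y * H (p + 1) y x :=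
  mul_nonneg (hr.G_nonneg p y) (hr.H_nonneg (p + 1) y x)

lemma abs_Bpath_le (e : ℕ → Measure X) (p : ℕ) (x : X) {F : (Fin p → X) → ℝ} {M : ℝ}
    (hF : ∀ z, |F z| ≤ M) : |Bpath G H e p x F| ≤ M := by
  induction p generalizing x with
  | zero => exact hF _
  | succ p ih =>
    have hM : 0 ≤ M := (abs_nonneg _).trans (hF fun _ => x)
    simp only [Bpath]
    by_cases hi : Integrable (fun y => G p y * H (p + 1) y x) (e p)
    · have hd : 0 ≤ ∫ y, G p y * H (p + 1) y x ∂(e p) :=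
        integral_nonneg fun y => hr.backWeight_nonneg p x y
      rw [abs_div, abs_of_nonneg hd]
      refine div_le_of_le_mul₀ hd hM ?_
      rw [← Real.norm_eq_abs, ← integral_const_mul]
      refine norm_integral_le_of_norm_le (hi.const_mul M) (ae_of_all _ fun y => ?_)
      rw [Real.norm_eq_abs, abs_mul, abs_of_nonneg (hr.backWeight_nonneg p x y), mul_comm]
      exact mul_le_mul_of_nonneg_right (ih y fun z => hF _) (hr.backWeight_nonneg p x y)
    · simpa [integral_undef hi] using hM

lemma measurable_Bpath {Ω : Type*} [MeasurableSpace Ω] (κ : ℕ → Kernel Ω X)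
    [hκ : ∀ k, IsSFiniteKernel (κ k)] (p : ℕ) {x : Ω → X} (hx : Measurable x)
    {F : Ω → (Fin p → X) → ℝ} (hF : Measurable (Function.uncurry F)) :
    Measurable fun ω => Bpath G H (fun k => κ k ω) p (x ω) (F ω) := by
  induction p generalizing Ω with
  | zero =>
    simp only [Bpath]
    exact hF.comp (measurable_id.prodMk measurable_const)
  | succ p ih =>
    have hF' : Measurable (Function.uncurry fun (w : Ω × X) (z : Fin p → X) =>
        F w.1 (Fin.snoc z w.2)) :=
      hF.comp ((measurable_fst.comp measurable_fst).prodMk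
        ((measurable_snoc p).comp (measurable_snd.prodMk (measurable_snd.comp measurable_fst))))
    have h1 : Measurable fun w : Ω × X => Bpath G H (fun k => κ k w.1) p w.2
        (fun z => F w.1 (Fin.snoc z w.2)) :=
      ih (fun k => (κ k).comap Prod.fst measurable_fst) measurable_snd hF'
    have h2 : Measurable fun w : Ω × X => G p w.2 * H (p + 1) w.2 (x w.1) :=
      ((hr.measurable_G p).comp measurable_snd).mul
        ((hr.measurable_H (p + 1)).comp (measurable_snd.prodMk (hx.comp measurable_fst)))
    simp only [Bpath]
    exact (StronglyMeasurable.integral_kernel_prod_right' (κ := κ p)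
        (h2.mul h1).stronglyMeasurable).measurable.div
      (StronglyMeasurable.integral_kernel_prod_right' (κ := κ p) h2.stronglyMeasurable).measurable

lemma measurable_Bpath_empSeq {Ω : Type*} [MeasurableSpace Ω] (N n p : ℕ)
    {t : Ω → Fin (n + 1) → Fin N → X} (ht : Measurable t) {x : Ω → X} (hx : Measurable x)
    {F : Ω → (Fin p → X) → ℝ} (hF : Measurable (Function.uncurry F)) :
    Measurable fun ω => Bpath G H (empSeq N n (t ω)) p (x ω) (F ω) := by
  have h := hr.measurable_Bpath (fun k => (empSeqKernel X N n k).comap t ht) p hx hF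
  simpa only [Kernel.comap_apply, empSeqKernel_apply] using h

lemma measurable_Bpath_eta {Ω : Type*} [MeasurableSpace Ω] (p : ℕ)
    {x : Ω → X} (hx : Measurable x)
    {F : Ω → (Fin p → X) → ℝ} (hF : Measurable (Function.uncurry F)) :
    Measurable fun ω => Bpath G H (eta lam mu G H) p (x ω) (F ω) := by
  have := hr.isFiniteMeasure_eta (mu := mu)
  exact hr.measurable_Bpath (fun k => Kernel.const Ω (eta lam mu G H k)) p hx hF

lemma ae_integrable_backWeight (p : ℕ) :
    ∀ᵐ x ∂lam, Integrable (fun y => G p y * H (p + 1) y x) (gammaM lam mu G H p) := by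
  have := hr.isFiniteMeasure_gammaM (mu := mu) p
  have := hr.isFiniteMeasure_gammaM (mu := mu) (p + 1)
  have h := hr.lintegral_stepM_swap p (gammaM lam mu G H p) (f := fun _ => 1) measurable_const
  have hfin : ∫⁻ x, ∫⁻ y, ENNReal.ofReal (G p y * H (p + 1) y x) ∂(gammaM lam mu G H p) ∂lam
      ≠ ∞ := by
    simp only [one_mul] at h
    rw [← h, lintegral_one]
    exact measure_ne_top (gammaM lam mu G H (p + 1)) Set.univ
  have hm : Measurable fun x =>
      ∫⁻ y, ENNReal.ofReal (G p y * H (p + 1) y x) ∂(gammaM lam mu G H p) :=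
    Measurable.lintegral_prod_right' (f := fun z : X × X =>
      ENNReal.ofReal (G p z.2 * H (p + 1) z.2 z.1))
      (((hr.measurable_G p).comp measurable_snd).mul
        ((hr.measurable_H (p + 1)).comp measurable_swap)).ennreal_ofReal
  filter_upwards [ae_lt_top hm hfin] with x hx
  refine ⟨(hr.measurable_backWeight p x).aestronglyMeasurable, ?_⟩
  refine (lintegral_congr fun y => ?_).trans_lt hx
  rw [Real.enorm_eq_ofReal (hr.backWeight_nonneg p x y)]

end IsRegular

end

section

variable {X : Type} [MeasurableSpace X]

variable {lam mu : Measure X} [SigmaFinite lam] [IsProbabilityMeasure mu]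
  {G : ℕ → X → ℝ} {H : ℕ → X → X → ℝ}

lemma enorm_sub_le_of_abs_le {a b M : ℝ} (ha : |a| ≤ M) (hb : |b| ≤ M) :
    ‖a - b‖ₑ ≤ ENNReal.ofReal (2 * M) := by
  rw [Real.enorm_eq_ofReal_abs]
  exact ENNReal.ofReal_le_ofReal (by linarith [abs_sub a b])

lemma measurable_snoc_section {p : ℕ} {F : (Fin (p + 1) → X) → ℝ} (hF : Measurable F)
    {Ω : Type*} [MeasurableSpace Ω] {y : Ω → X} (hy : Measurable y) :
    Measurable (Function.uncurry fun (ω : Ω) (z : Fin p → X) => F (Fin.snoc z (y ω))) :=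
  hF.comp ((measurable_snoc p).comp (measurable_snd.prodMk (hy.comp measurable_fst)))

/-- Stability of ratios of empirical integrals. -/
lemma ofReal_mul_enorm_div_sub_le (N : ℕ) (c : Fin N → X) {g b b' : X → ℝ} (hg : Measurable g)
    (hb : Measurable b) (hb' : Measurable b') (hg0 : ∀ y, 0 ≤ g y) {M B : ℝ}
    (hM : ∀ y, |b' y| ≤ M) (hB : |B| ≤ M) {d : ℝ} (hd : 0 ≤ d) :
    ENNReal.ofReal d * ‖(∫ y, g y * b' y ∂(emp N c)) / (∫ y, g y ∂(emp N c)) - B‖ₑ ≤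
      ENNReal.ofReal (2 * M) * ‖∫ y, g y ∂(emp N c) - d‖ₑ +
      ∫⁻ y, ENNReal.ofReal (g y) * ‖b' y - b y‖ₑ ∂(emp N c) +
      ‖∫ y, g y * (b y - B) ∂(emp N c)‖ₑ := by
  set ν := emp N c
  set D := ∫ y, g y ∂ν
  set A := ∫ y, g y * b' y ∂ν
  have hgi : Integrable g ν := integrable_emp N c hg
  have hD0 : 0 ≤ D := integral_nonneg hg0
  have hM0 : 0 ≤ M := (abs_nonneg _).trans hB
  have hA : |A| ≤ M * D := by
    rw [← Real.norm_eq_abs, ← integral_const_mul]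
    refine norm_integral_le_of_norm_le (hgi.const_mul M) (ae_of_all _ fun y => ?_)
    rw [Real.norm_eq_abs, abs_mul, abs_of_nonneg (hg0 y), mul_comm]
    exact mul_le_mul_of_nonneg_right (hM y) (hg0 y)
  have hq : |A / D| ≤ M := by
    rw [abs_div, abs_of_nonneg hD0]
    exact div_le_of_le_mul₀ hD0 hM0 hA
  have hDA : D * (A / D) = A := by
    rcases eq_or_ne D 0 with h | h
    · have : A = 0 := abs_nonpos_iff.1 (by simpa [h] using hA)
      simp [this]
    · field_simp
  have hsplit : A - D * B = ∫ y, g y * (b' y - b y) ∂ν + ∫ y, g y * (b y - B) ∂ν := by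
    have h1 : Integrable (fun y => g y * (b' y - b y)) ν :=
      integrable_emp N c (hg.mul (hb'.sub hb))
    have h2 : Integrable (fun y => g y * (b y - B)) ν :=
      integrable_emp N c (hg.mul (hb.sub_const B))
    have h3 : Integrable (fun y => g y * b' y) ν := integrable_emp N c (hg.mul hb')
    rw [← integral_add h1 h2, mul_comm, ← integral_const_mul, ← integral_sub h3 (hgi.const_mul B)]
    exact integral_congr_ae (ae_of_all _ fun y => by simp only; ring)
  have hkey : d * (A / D - B) = -((A / D - B) * (D - d)) +
      (∫ y, g y * (b' y - b y) ∂ν + ∫ y, g y * (b y - B) ∂ν) := by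
    rw [← hsplit]
    linear_combination hDA
  rw [← Real.enorm_eq_ofReal hd, ← enorm_mul, hkey]
  refine (enorm_add_le _ _).trans ?_
  rw [add_assoc]
  refine add_le_add ?_ ((enorm_add_le _ _).trans (add_le_add ?_ le_rfl))
  · rw [enorm_neg, enorm_mul]
    gcongr
    exact enorm_sub_le_of_abs_le hq hB
  · refine (enorm_integral_le_lintegral_enorm _).trans (lintegral_mono fun y => ?_)
    rw [enorm_mul, Real.enorm_eq_ofReal (hg0 y)]

namespace IsRegular

variable (hr : IsRegular lam G H)
include hr

lemma tendsto_of_backWeight_null (p : ℕ) {F : (Fin (p + 1) → X) → ℝ} (x : X)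
    (h0 : ∫⁻ y, ENNReal.ofReal (G p y * H (p + 1) y x) ∂(gammaM lam mu G H p) = 0) :
    Tendsto (fun N : ℕ => ∫⁻ t, ‖Bpath G H (empSeq N p t) (p + 1) x F -
      Bpath G H (eta lam mu G H) (p + 1) x F‖ₑ ∂(tilted lam mu G H N p)) atTop (𝓝 0) := by
  have hm := hr.measurable_backWeight p x
  have hnn := hr.backWeight_nonneg p x
  have hzero : ∀ ν : Measure X, ∫⁻ y, ENNReal.ofReal (G p y * H (p + 1) y x) ∂ν = 0 →
      ∫ y, G p y * H (p + 1) y x ∂ν = 0 := fun ν h => by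
    rw [integral_eq_lintegral_of_nonneg_ae (ae_of_all _ hnn) hm.aestronglyMeasurable, h]
    rfl
  have hB : Bpath G H (eta lam mu G H) (p + 1) x F = 0 := by
    simp only [Bpath]
    rw [integral_eta p fun y => G p y * H (p + 1) y x, hzero _ h0]
    simp
  refine tendsto_const_nhds.congr fun N => ?_
  have hz := le_antisymm ((hr.lintegral_tilted_emp_le (mu := mu) N p
    hm.ennreal_ofReal).trans h0.le) zero_le
  rw [lintegral_eq_zero_iff (hr.measurable_lintegral_emp N (p + 1) hm.ennreal_ofReal
    (Fin.last p))] at hz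
  symm
  rw [← lintegral_zero (μ := tilted lam mu G H N p)]
  refine lintegral_congr_ae ?_
  filter_upwards [hz] with t ht
  have : Bpath G H (empSeq N p t) (p + 1) x F = 0 := by
    simp only [Bpath, empSeq_self]
    rw [hzero _ ht]
    exact div_zero _
  rw [hB, this]
  simp

lemma integral_eta_backWeight_pos (p : ℕ) (x : X)
    (hi : Integrable (fun y => G p y * H (p + 1) y x) (gammaM lam mu G H p))
    (h0 : ∫⁻ y, ENNReal.ofReal (G p y * H (p + 1) y x) ∂(gammaM lam mu G H p) ≠ 0) :
    0 < ∫ y, G p y * H (p + 1) y x ∂(eta lam mu G H p) := by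
  have := hr.isFiniteMeasure_gammaM (mu := mu) p
  have hg0 : gammaM lam mu G H p Set.univ ≠ 0 := by
    intro h2
    rw [Measure.measure_univ_eq_zero] at h2
    simp [h2] at h0
  rw [integral_eta p fun y => G p y * H (p + 1) y x]
  refine mul_pos (ENNReal.toReal_pos (by simp) (by simp [hg0])) ?_
  rw [← ofReal_integral_eq_lintegral_ofReal hi
    (ae_of_all _ (hr.backWeight_nonneg p x))] at h0
  exact ENNReal.ofReal_pos.1 (pos_iff_ne_zero.2 h0)

/-- One step of the induction for the convergence of the particle backward kernels, given the
convergence of the remainder coming from the earlier times. -/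
lemma tendsto_Bpath_succ (p : ℕ) {F : (Fin (p + 1) → X) → ℝ} (hF : Measurable F) {M : ℝ}
    (hM : ∀ z, |F z| ≤ M) (x : X)
    (hi : Integrable (fun y => G p y * H (p + 1) y x) (gammaM lam mu G H p))
    (hmid : Tendsto (fun N : ℕ => ∫⁻ t, ∫⁻ y, ENNReal.ofReal (G p y * H (p + 1) y x) *
      ‖Bpath G H (empSeq N p t) p y (fun z => F (Fin.snoc z y)) -
        Bpath G H (eta lam mu G H) p y (fun z => F (Fin.snoc z y))‖ₑ
        ∂(emp N (t (Fin.last p))) ∂(tilted lam mu G H N p)) atTop (𝓝 0)) :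
    Tendsto (fun N : ℕ => ∫⁻ t, ‖Bpath G H (empSeq N p t) (p + 1) x F -
      Bpath G H (eta lam mu G H) (p + 1) x F‖ₑ ∂(tilted lam mu G H N p)) atTop (𝓝 0) := by
  by_cases h0 : ∫⁻ y, ENNReal.ofReal (G p y * H (p + 1) y x) ∂(gammaM lam mu G H p) = 0
  · exact hr.tendsto_of_backWeight_null p x h0
  have hfin := hr.isFiniteMeasure_gammaM (mu := mu) p
  have hm := hr.measurable_backWeight p x
  set d := ∫ y, G p y * H (p + 1) y x ∂(eta lam mu G H p) with hd
  have hdpos : 0 < d := hr.integral_eta_backWeight_pos p x hi h0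
  set b : X → ℝ := fun y => Bpath G H (eta lam mu G H) p y (fun z => F (Fin.snoc z y)) with hbdef
  have hbm : Measurable b :=
    hr.measurable_Bpath_eta p measurable_id (measurable_snoc_section hF measurable_id)
  have hbM : ∀ y, |b y| ≤ M := fun y => hr.abs_Bpath_le _ p y fun z => hM _
  set B := Bpath G H (eta lam mu G H) (p + 1) x F with hBdef
  have hBM : |B| ≤ M := hr.abs_Bpath_le _ (p + 1) x hM
  have hgb : Integrable (fun y => (G p y * H (p + 1) y x) * b y) (gammaM lam mu G H p) :=
    hi.mul_bdd hbm.aestronglyMeasurable (ae_of_all _ hbM)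
  have hgbB : Integrable (fun y => (G p y * H (p + 1) y x) * (b y - B)) (gammaM lam mu G H p) := by
    simp_rw [mul_sub]
    exact hgb.sub (hi.mul_const B)
  have hmean : ∫ y, (G p y * H (p + 1) y x) * (b y - B) ∂(eta lam mu G H p) = 0 := by
    have hinv : (gammaM lam mu G H p Set.univ)⁻¹ ≠ ∞ := by
      intro h
      rw [ENNReal.inv_eq_top, Measure.measure_univ_eq_zero] at h
      simp [h] at h0
    have h1 : Integrable (fun y => (G p y * H (p + 1) y x) * b y) (eta lam mu G H p) :=
      hgb.smul_measure hinv
    have h2 : Integrable (fun y => (G p y * H (p + 1) y x) * B) (eta lam mu G H p) :=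
      (hi.mul_const B).smul_measure hinv
    simp_rw [mul_sub]
    rw [integral_sub h1 h2, integral_mul_const, ← hd]
    have : B = (∫ y, (G p y * H (p + 1) y x) * b y ∂(eta lam mu G H p)) / d := rfl
    rw [this]
    field_simp
    ring
  have hL1 := ENNReal.Tendsto.const_mul (a := ENNReal.ofReal (2 * M))
    (hr.tendsto_lintegral_enorm_emp_sub (mu := mu) p hm hi) (Or.inr ofReal_ne_top)
  have hL2 := hr.tendsto_lintegral_enorm_emp_sub (mu := mu) p
    (f := fun y => (G p y * H (p + 1) y x) * (b y - B)) (hm.mul (hbm.sub_const B)) hgbB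
  have hsum := ENNReal.Tendsto.const_mul (a := (ENNReal.ofReal d)⁻¹) ((hL1.add hmid).add hL2)
    (Or.inr (by simp [hdpos]))
  simp only [add_zero, mul_zero] at hsum
  refine tendsto_of_tendsto_of_tendsto_of_le_of_le tendsto_const_nhds hsum
    (fun _ => zero_le) fun N => ?_
  have hb' : Measurable fun w : (Fin (p + 1) → Fin N → X) × X =>
      Bpath G H (empSeq N p w.1) p w.2 (fun z => F (Fin.snoc z w.2)) :=
    hr.measurable_Bpath_empSeq N p p measurable_fst measurable_snd
      (measurable_snoc_section hF measurable_snd)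
  have hm1 : Measurable fun t : Fin (p + 1) → Fin N → X =>
      ‖∫ y, G p y * H (p + 1) y x ∂(emp N (t (Fin.last p))) - d‖ₑ :=
    ((measurable_integral_emp N (p + 1) hm (Fin.last p)).sub_const d).enorm
  have hm2 : Measurable fun t : Fin (p + 1) → Fin N → X =>
      ∫⁻ y, ENNReal.ofReal (G p y * H (p + 1) y x) *
      ‖Bpath G H (empSeq N p t) p y (fun z => F (Fin.snoc z y)) - b y‖ₑ
        ∂(emp N (t (Fin.last p))) :=
    Measurable.lintegral_kernel_prod_right' (κ := empKernel X N (p + 1) (Fin.last p))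
      (f := fun w => ENNReal.ofReal (G p w.2 * H (p + 1) w.2 x) *
        ‖Bpath G H (empSeq N p w.1) p w.2 (fun z => F (Fin.snoc z w.2)) - b w.2‖ₑ)
      ((hm.comp measurable_snd).ennreal_ofReal.mul
        (hb'.sub (hbm.comp measurable_snd)).enorm)
  have hm12 : Measurable fun t : Fin (p + 1) → Fin N → X =>
      ENNReal.ofReal (2 * M) * ‖∫ y, G p y * H (p + 1) y x ∂(emp N (t (Fin.last p))) - d‖ₑ +
      ∫⁻ y, ENNReal.ofReal (G p y * H (p + 1) y x) *
      ‖Bpath G H (empSeq N p t) p y (fun z => F (Fin.snoc z y)) - b y‖ₑ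
        ∂(emp N (t (Fin.last p))) := (hm1.const_mul _).add hm2
  simp only
  rw [← lintegral_const_mul _ hm1, ← lintegral_add_left (hm1.const_mul _),
    ← lintegral_add_left hm12, hmean]
  simp only [sub_zero]
  rw [← lintegral_const_mul' _ _ (by simp [hdpos])]
  refine lintegral_mono fun t => ?_
  rw [mul_comm, ← div_eq_mul_inv, ENNReal.le_div_iff_mul_le (Or.inl (by simp [hdpos]))
    (Or.inl ofReal_ne_top), mul_comm]
  have := ofReal_mul_enorm_div_sub_le N (t (Fin.last p)) hm hbm
    (hb'.comp (measurable_prodMk_left (x := t))) (hr.backWeight_nonneg p x)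
    (fun y => hr.abs_Bpath_le _ p y fun z => hM _) hBM hdpos.le
  simpa only [Bpath, empSeq_self, Function.comp_def] using this

end IsRegular

end

section

variable {X : Type} [MeasurableSpace X]

variable {lam mu : Measure X} [SigmaFinite lam] [IsProbabilityMeasure mu]
  {G : ℕ → X → ℝ} {H : ℕ → X → X → ℝ}

namespace IsRegular

variable (hr : IsRegular lam G H)
include hr

lemma measurable_lintegral_backWeight_emp (N n : ℕ) :
    Measurable fun w : (Fin (n + 1) → Fin N → X) × X =>
      ∫⁻ x, ENNReal.ofReal (G n x * H (n + 1) x w.2) ∂(emp N (w.1 (Fin.last n))) :=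
  Measurable.lintegral_kernel_prod_right'
    (κ := (empKernel X N (n + 1) (Fin.last n)).comap
      (Prod.fst : (Fin (n + 1) → Fin N → X) × X → _) measurable_fst)
    (f := fun w => ENNReal.ofReal (G n w.2 * H (n + 1) w.2 w.1.2))
    (((hr.measurable_G n).comp measurable_snd).mul
      ((hr.measurable_H (n + 1)).comp
        (measurable_snd.prodMk (measurable_snd.comp measurable_fst)))).ennreal_ofReal

/-- Change of the order of integration between the new particle and the past trajectory. -/
lemma lintegral_tilted_stepM_swap (N n : ℕ) (hN : N ≠ 0)
    {g : (Fin (n + 1) → Fin N → X) → X → ℝ≥0∞} (hg : Measurable (Function.uncurry g)) :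
    ∫⁻ t, ∫⁻ y, g t y ∂(stepM lam G H n (emp N (t (Fin.last n)))) ∂(tilted lam mu G H N n) =
      ∫⁻ y, ∫⁻ t, g t y * ∫⁻ x, ENNReal.ofReal (G n x * H (n + 1) x y)
        ∂(emp N (t (Fin.last n))) ∂(tilted lam mu G H N n) ∂lam := by
  have := hr.isFiniteMeasure_tilted (mu := mu) N n hN
  have hgt : ∀ t, Measurable (g t) := fun t => hg.comp measurable_prodMk_left
  simp_rw [fun t : Fin (n + 1) → Fin N → X =>
    hr.lintegral_stepM_swap n (emp N (t (Fin.last n))) (hgt t)]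
  have hm : Measurable fun w : (Fin (n + 1) → Fin N → X) × X =>
      g w.1 w.2 * ∫⁻ x, ENNReal.ofReal (G n x * H (n + 1) x w.2) ∂(emp N (w.1 (Fin.last n))) :=
    hg.mul (hr.measurable_lintegral_backWeight_emp N n)
  exact lintegral_lintegral_swap hm.aemeasurable

lemma tendsto_lintegral_mul_backWeight (n : ℕ) (y : X)
    (hi : Integrable (fun x => G n x * H (n + 1) x y) (gammaM lam mu G H n))
    {u : (N : ℕ) → (Fin (n + 1) → Fin N → X) → ℝ≥0∞} (hum : ∀ N, Measurable (u N))
    {C : ℝ≥0∞} (hC : C ≠ ∞) (hu : ∀ N t, u N t ≤ C)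
    (h : Tendsto (fun N => ∫⁻ t, u N t ∂(tilted lam mu G H N n)) atTop (𝓝 0)) :
    Tendsto (fun N => ∫⁻ t, u N t * ∫⁻ x, ENNReal.ofReal (G n x * H (n + 1) x y)
        ∂(emp N (t (Fin.last n))) ∂(tilted lam mu G H N n)) atTop (𝓝 0) := by
  have hm := hr.measurable_backWeight n y
  set a := ∫ x, G n x * H (n + 1) x y ∂(eta lam mu G H n)
  have hL := ENNReal.Tendsto.const_mul (a := C)
    (hr.tendsto_lintegral_enorm_emp_sub (mu := mu) n hm hi) (Or.inr hC)
  have hU := ENNReal.Tendsto.const_mul (a := ENNReal.ofReal a) h (Or.inr ofReal_ne_top)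
  have hsum := hL.add hU
  simp only [add_zero, mul_zero] at hsum
  refine tendsto_of_tendsto_of_tendsto_of_le_of_le tendsto_const_nhds hsum
    (fun _ => zero_le) fun N => ?_
  simp only
  have hm1 : Measurable fun t : Fin (n + 1) → Fin N → X =>
      ‖∫ x, G n x * H (n + 1) x y ∂(emp N (t (Fin.last n))) - a‖ₑ :=
    ((measurable_integral_emp N (n + 1) hm (Fin.last n)).sub_const a).enorm
  rw [← lintegral_const_mul _ hm1, ← lintegral_const_mul _ (hum N),
    ← lintegral_add_left (hm1.const_mul C)]
  refine lintegral_mono fun t => ?_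
  rw [← ofReal_integral_eq_lintegral_ofReal (integrable_emp N _ hm)
    (ae_of_all _ (hr.backWeight_nonneg n y))]
  set I := ∫ x, G n x * H (n + 1) x y ∂(emp N (t (Fin.last n)))
  have hI : ENNReal.ofReal I ≤ ‖I - a‖ₑ + ENNReal.ofReal a := by
    rw [Real.enorm_eq_ofReal_abs]
    refine le_trans (ENNReal.ofReal_le_ofReal ?_) ENNReal.ofReal_add_le
    linarith [le_abs_self (I - a)]
  calc u N t * ENNReal.ofReal I ≤ u N t * (‖I - a‖ₑ + ENNReal.ofReal a) := by gcongr
    _ = u N t * ‖I - a‖ₑ + ENNReal.ofReal a * u N t := by ring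
    _ ≤ C * ‖I - a‖ₑ + ENNReal.ofReal a * u N t := by gcongr; exact hu N t

lemma lintegral_tilted_mul_backWeight_le (N n : ℕ) (y : X) (c : ℝ≥0∞)
    {u : (Fin (n + 1) → Fin N → X) → ℝ≥0∞} {C : ℝ≥0∞} (hu : ∀ t, u t ≤ C) :
    ∫⁻ t, c * u t * ∫⁻ x, ENNReal.ofReal (G n x * H (n + 1) x y)
        ∂(emp N (t (Fin.last n))) ∂(tilted lam mu G H N n) ≤
      C * (c * ∫⁻ x, ENNReal.ofReal (G n x * H (n + 1) x y) ∂(gammaM lam mu G H n)) := by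
  have hm := (hr.measurable_backWeight n y).ennreal_ofReal
  have h := hr.lintegral_tilted_emp_le (mu := mu) N n hm
  rw [← mul_assoc, mul_comm C c]
  refine le_trans ?_ (mul_le_mul_right h (c * C))
  rw [← lintegral_const_mul _ (hr.measurable_lintegral_emp N (n + 1) hm (Fin.last n))]
  exact lintegral_mono fun t => mul_le_mul_left (mul_le_mul_right (hu t) c) _

lemma tendsto_lintegral_lintegral_backWeight (n : ℕ) {g : X → ℝ≥0∞} (hg : Measurable g)
    (hgtop : ∀ y, g y ≠ ∞) (hgi : ∫⁻ y, g y ∂(gammaM lam mu G H (n + 1)) ≠ ∞)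
    {u : (N : ℕ) → (Fin (n + 1) → Fin N → X) → X → ℝ≥0∞}
    (hum : ∀ N, Measurable (Function.uncurry (u N)))
    {C : ℝ≥0∞} (hC : C ≠ ∞) (hu : ∀ N t y, u N t y ≤ C)
    (h : ∀ y, Integrable (fun x => G n x * H (n + 1) x y) (gammaM lam mu G H n) →
      Tendsto (fun N => ∫⁻ t, u N t y ∂(tilted lam mu G H N n)) atTop (𝓝 0)) :
    Tendsto (fun N : ℕ => ∫⁻ y, ∫⁻ t, g y * u N t y *
        ∫⁻ x, ENNReal.ofReal (G n x * H (n + 1) x y) ∂(emp N (t (Fin.last n)))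
        ∂(tilted lam mu G H N n) ∂lam) atTop (𝓝 0) := by
  have hfin := hr.isFiniteMeasure_gammaM (mu := mu) n
  rw [← lintegral_zero (μ := lam)]
  refine tendsto_lintegral_filter_of_dominated_convergence
    (fun y => C * (g y * ∫⁻ x, ENNReal.ofReal (G n x * H (n + 1) x y) ∂(gammaM lam mu G H n)))
    ?_ (Eventually.of_forall fun N => ae_of_all _ fun y =>
      hr.lintegral_tilted_mul_backWeight_le N n y (g y) fun t => hu N t y) ?_ ?_
  · filter_upwards [eventually_ne_atTop 0] with N hN
    have := hr.isFiniteMeasure_tilted (mu := mu) N n hN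
    have hm : Measurable fun w : (Fin (n + 1) → Fin N → X) × X => g w.2 * u N w.1 w.2 *
        ∫⁻ x, ENNReal.ofReal (G n x * H (n + 1) x w.2) ∂(emp N (w.1 (Fin.last n))) :=
      ((hg.comp measurable_snd).mul (hum N)).mul (hr.measurable_lintegral_backWeight_emp N n)
    exact hm.lintegral_prod_left'
  · rw [lintegral_const_mul' _ _ hC, ← hr.lintegral_stepM_swap n (gammaM lam mu G H n) hg]
    exact ENNReal.mul_ne_top hC hgi
  · filter_upwards [hr.ae_integrable_backWeight (mu := mu) n] with y hy
    have h3 := hr.tendsto_lintegral_mul_backWeight n y hy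
      (u := fun N t => u N t y) (fun N => (hum N).comp measurable_prodMk_right)
      hC (fun N t => hu N t y) (h y hy)
    have h4 := ENNReal.Tendsto.const_mul (a := g y) h3 (Or.inr (hgtop y))
    rw [mul_zero] at h4
    refine h4.congr fun N => ?_
    rw [← lintegral_const_mul' _ _ (hgtop y)]
    simp only [mul_assoc]

/-- Convergence in weighted mean of the particle approximation of the backward kernels. -/
lemma tendsto_lintegral_enorm_Bpath_sub (p : ℕ) {F : (Fin (p + 1) → X) → ℝ}
    (hF : Measurable F) {M : ℝ} (hM : ∀ z, |F z| ≤ M) (x : X)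
    (hi : Integrable (fun y => G p y * H (p + 1) y x) (gammaM lam mu G H p)) :
    Tendsto (fun N : ℕ => ∫⁻ t, ‖Bpath G H (empSeq N p t) (p + 1) x F -
      Bpath G H (eta lam mu G H) (p + 1) x F‖ₑ ∂(tilted lam mu G H N p)) atTop (𝓝 0) := by
  induction p generalizing x with
  | zero =>
    refine hr.tendsto_Bpath_succ 0 hF hM x hi ?_
    simp [Bpath]
  | succ p ih =>
    refine hr.tendsto_Bpath_succ (p + 1) hF hM x hi ?_
    have hgm := hr.measurable_backWeight (p + 1) x
    have hum : ∀ N, Measurable fun w : (Fin (p + 1) → Fin N → X) × X =>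
        ‖Bpath G H (empSeq N p w.1) (p + 1) w.2 (fun z => F (Fin.snoc z w.2)) -
          Bpath G H (eta lam mu G H) (p + 1) w.2 (fun z => F (Fin.snoc z w.2))‖ₑ := fun N =>
      ((hr.measurable_Bpath_empSeq N p (p + 1) measurable_fst measurable_snd
        (measurable_snoc_section hF measurable_snd)).sub
        (hr.measurable_Bpath_eta (p + 1) measurable_snd
          (measurable_snoc_section hF measurable_snd))).enorm
    have hlim := hr.tendsto_lintegral_lintegral_backWeight p hgm.ennreal_ofReal
      (fun _ => ofReal_ne_top) (Integrable.lintegral_lt_top hi).ne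
      (u := fun N t y => ‖Bpath G H (empSeq N p t) (p + 1) y (fun z => F (Fin.snoc z y)) -
        Bpath G H (eta lam mu G H) (p + 1) y (fun z => F (Fin.snoc z y))‖ₑ) hum
      ofReal_ne_top
      (fun N t y => enorm_sub_le_of_abs_le (hr.abs_Bpath_le _ _ _ fun z => hM _)
        (hr.abs_Bpath_le _ _ _ fun z => hM _))
      (fun y hy => ih (F := fun z => F (Fin.snoc z y))
        (hF.comp ((measurable_snoc (p + 1)).comp measurable_prodMk_right)) (fun z => hM _) y hy)
    refine tendsto_of_tendsto_of_tendsto_of_le_of_le' tendsto_const_nhds hlim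
      (Eventually.of_forall fun _ => zero_le) ?_
    filter_upwards [eventually_ne_atTop 0] with N hN
    have hgu : Measurable (Function.uncurry fun (t : Fin (p + 1) → Fin N → X) (y : X) =>
        ENNReal.ofReal (G (p + 1) y * H (p + 1 + 1) y x) *
        ‖Bpath G H (empSeq N p t) (p + 1) y (fun z => F (Fin.snoc z y)) -
          Bpath G H (eta lam mu G H) (p + 1) y (fun z => F (Fin.snoc z y))‖ₑ) :=
      (hgm.ennreal_ofReal.comp measurable_snd).mul (hum N)
    refine le_trans (le_of_eq (lintegral_congr fun t => lintegral_congr fun y => ?_))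
      ((hr.lintegral_tilted_succ_emp_le N p hgu).trans
        (hr.lintegral_tilted_stepM_swap N p hN hgu).le)
    rw [Bpath_congr G H (p + 1) fun k hk => empSeq_init N p k hk t]

end IsRegular

end

section

variable {X : Type} [MeasurableSpace X]

lemma measurable_append_snoc (p k : ℕ) (x : X) :
    Measurable fun w : (Fin p → X) × (Fin k → X) =>
      Fin.append (Fin.snoc w.1 x : Fin (p + 1) → X) w.2 := by
  refine measurable_pi_iff.2 fun i => ?_
  refine Fin.addCases (fun j => ?_) (fun j => ?_) i
  · simp only [Fin.append_left]
    exact (measurable_pi_apply j).comp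
      ((measurable_snoc p).comp (measurable_fst.prodMk measurable_const))
  · simp only [Fin.append_right]
    exact (measurable_pi_apply j).comp measurable_snd

variable {lam mu : Measure X} [SigmaFinite lam] [IsProbabilityMeasure mu]
  {G : ℕ → X → ℝ} {H : ℕ → X → X → ℝ}

namespace IsRegular

variable (hr : IsRegular lam G H)
include hr

lemma measurable_Fpath {Ω : Type*} [MeasurableSpace Ω] (p k : ℕ) {x : Ω → X} (hx : Measurable x)
    {F : Ω → (Fin k → X) → ℝ} (hF : Measurable (Function.uncurry F)) :
    Measurable fun ω => Fpath lam G H p k (x ω) (F ω) := by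
  induction k generalizing Ω p with
  | zero =>
    simp only [Fpath]
    exact hF.comp (measurable_id.prodMk measurable_const)
  | succ k ih =>
    have hF' : Measurable (Function.uncurry fun (w : Ω × X) (z : Fin k → X) =>
        F w.1 (Fin.cons w.2 z)) :=
      hF.comp ((measurable_fst.comp measurable_fst).prodMk
        ((measurable_cons k).comp ((measurable_snd.comp measurable_fst).prodMk measurable_snd)))
    have h1 : Measurable fun w : Ω × X => H (p + 1) (x w.1) w.2 *
        Fpath lam G H (p + 1) k w.2 (fun z => F w.1 (Fin.cons w.2 z)) :=
      ((hr.measurable_H (p + 1)).comp ((hx.comp measurable_fst).prodMk measurable_snd)).mul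
        (ih (p + 1) measurable_snd hF')
    simp only [Fpath]
    exact ((hr.measurable_G p).comp hx).mul
      (h1.stronglyMeasurable.integral_prod_right' (ν := lam)).measurable

lemma exists_abs_Fpath_le (p k : ℕ) (M : ℝ) : ∃ C, ∀ x (F : (Fin k → X) → ℝ),
    (∀ z, |F z| ≤ M) → |Fpath lam G H p k x F| ≤ C := by
  induction k generalizing p with
  | zero => exact ⟨M, fun x F hF => hF _⟩
  | succ k ih =>
    obtain ⟨C, hC⟩ := ih (p + 1)
    obtain ⟨D, hD⟩ := hr.bounded_G p
    refine ⟨D * C, fun x F hF => ?_⟩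
    have hC0 : 0 ≤ C := (abs_nonneg _).trans (hC x (fun z => F (Fin.cons x z)) fun z => hF _)
    have h1 := hr.integral_H (p + 1) (Nat.succ_pos p) x
    have hi : Integrable (fun y => H (p + 1) x y) lam :=
      integrable_of_integral_eq_one h1
    simp only [Fpath]
    rw [abs_mul, abs_of_nonneg (hr.G_nonneg p x)]
    refine mul_le_mul (hD x) ?_ (abs_nonneg _) ((hr.G_nonneg p x).trans (hD x))
    rw [← Real.norm_eq_abs]
    refine (norm_integral_le_of_norm_le (hi.mul_const C) (ae_of_all _ fun y => ?_)).trans ?_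
    · rw [Real.norm_eq_abs, abs_mul, abs_of_nonneg (hr.H_nonneg (p + 1) x y)]
      exact mul_le_mul_of_nonneg_left (hC y _ fun z => hF _) (hr.H_nonneg (p + 1) x y)
    · rw [integral_mul_const, h1, one_mul]

lemma measurableSet_Bpath_sub (N n p : ℕ) (x : X) {F : (Fin p → X) → ℝ} (hF : Measurable F)
    (c ε : ℝ) :
    MeasurableSet {t : Fin (n + 1) → Fin N → X | ε ≤ |Bpath G H (empSeq N n t) p x F - c|} :=
  measurableSet_le measurable_const
    (((hr.measurable_Bpath_empSeq N n p measurable_id measurable_const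
      (F := fun _ => F) (hF.comp measurable_snd)).sub_const c).abs)

/-- The particle backward integrals up to time `p` only involve the particles before time `p`. -/
lemma particleLaw_Bpath_le (N p n : ℕ) (hpn : p ≤ n) (x : X) {F : (Fin (p + 1) → X) → ℝ}
    (hF : Measurable F) (c ε : ℝ) :
    particleLaw lam mu G H N n {t | ε ≤ |Bpath G H (empSeq N n t) (p + 1) x F - c|} ≤
      particleLaw lam mu G H N p {t | ε ≤ |Bpath G H (empSeq N p t) (p + 1) x F - c|} := by
  induction n, hpn using Nat.le_induction with
  | base => exact le_rfl
  | succ n hpn ih =>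
    refine le_trans ?_ ih
    have hs := hr.measurableSet_Bpath_sub N n (p + 1) x hF c ε
    rw [← lintegral_indicator_one hs, ← lintegral_indicator_one
      (hr.measurableSet_Bpath_sub N (n + 1) (p + 1) x hF c ε)]
    refine le_trans (lintegral_mono fun t => ?_)
      (hr.lintegral_particleLaw_init_le N n (measurable_one.indicator hs))
    refine le_of_eq (Set.indicator_eq_indicator ?_ rfl)
    simp only [Set.mem_ofPred_eq]
    rw [Bpath_congr G H (p + 1) fun k hk => empSeq_init N n k (by omega) t]

/-- Convergence in probability of the particle approximation of the backward kernels. -/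
lemma tendsto_particleLaw_Bpath (p n : ℕ) (hpn : p ≤ n) (x : X)
    (hi : Integrable (fun y => G p y * H (p + 1) y x) (gammaM lam mu G H p))
    {F : (Fin (p + 1) → X) → ℝ} (hF : Measurable F) {M : ℝ} (hM : ∀ z, |F z| ≤ M)
    {ε : ℝ} (hε : 0 < ε) :
    Tendsto (fun N : ℕ => particleLaw lam mu G H N n
      {t | ε ≤ |Bpath G H (empSeq N n t) (p + 1) x F - Bpath G H (eta lam mu G H) (p + 1) x F|})
      atTop (𝓝 0) := by
  set c := Bpath G H (eta lam mu G H) (p + 1) x F with hc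
  refine tendsto_of_tendsto_of_tendsto_of_le_of_le tendsto_const_nhds ?_ (fun _ => zero_le)
    fun N => hr.particleLaw_Bpath_le N p n hpn x hF c ε
  have hs := fun N => hr.measurableSet_Bpath_sub N p (p + 1) x hF c ε
  have hL := ENNReal.Tendsto.const_mul (a := (ENNReal.ofReal ε)⁻¹)
    (hr.tendsto_lintegral_enorm_Bpath_sub (mu := mu) p hF hM x hi) (Or.inr (by simp [hε]))
  rw [mul_zero] at hL
  simp_rw [← fun N => lintegral_indicator_one (μ := particleLaw lam mu G H N p) (hs N)]
  refine hr.tendsto_lintegral_particleLaw p (fun N => measurable_one.indicator (hs N))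
    (fun N t => Set.indicator_le_self' (fun _ _ => zero_le) t) ?_
  refine tendsto_of_tendsto_of_tendsto_of_le_of_le tendsto_const_nhds hL (fun _ => zero_le)
    fun N => ?_
  simp only
  rw [← lintegral_const_mul' _ _ (by simp [hε])]
  refine lintegral_mono fun t => ?_
  rw [Set.indicator_apply]
  split_ifs with ht
  swap
  · exact zero_le
  rw [mul_comm, ← div_eq_mul_inv, ENNReal.le_div_iff_mul_le (Or.inl (by simp [hε]))
    (Or.inl ofReal_ne_top), Real.enorm_eq_ofReal_abs]
  simpa using ENNReal.ofReal_le_ofReal ht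

end IsRegular

end

end FK

theorem particle_backward_operator_convergence
    {X : Type} [MeasurableSpace X] (lam mu : Measure X) [SigmaFinite lam]
    [IsProbabilityMeasure mu]
    (G : ℕ → X → ℝ) (H : ℕ → X → X → ℝ)
    (hGmeas : ∀ n, Measurable (G n)) (hGnonneg : ∀ n x, 0 ≤ G n x)
    (hHmeas : ∀ n, Measurable (Function.uncurry (H n))) (hHnonneg : ∀ n x y, 0 ≤ H n x y)
    (hHdens : ∀ n, 1 ≤ n → ∀ x, ∫ y, H n x y ∂lam = 1)
    (V : X → ℝ) (hVmeas : Measurable V) (hV1 : ∀ x, 1 ≤ V x)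
    (hVunb : ∀ r : ℝ, ∃ x, r < V x)
    (δ dlow : ℝ) (hδ : δ ∈ Set.Ioo (0:ℝ) 1) (hdlow : 1 ≤ dlow)
    (hA1 : ∀ d, dlow < d → ∃ b : ℝ, ∀ n, 1 ≤ n → ∀ x,
      FK.Qop lam G H n (fun y => Real.exp (V y)) x ≤
        Real.exp ((1 - δ) * V x + if V x ≤ d then b else 0))
    (hA2 : Integrable (fun x => Real.exp (V x)) mu)
    (hA3 : ∀ α ∈ Set.Ioo (0:ℝ) (1/2), ∃ C : ℝ, ∀ n, 1 ≤ n → ∀ x y,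
      G (n - 1) x * H n x y /
          (∫ z, G (n - 1) z * H n z y ∂(FK.eta lam mu G H (n - 1))) ≤
        C * Real.exp (V x) ^ α * Real.exp (V y) ^ α)
    (hGbdd : ∀ n, ∃ C : ℝ, ∀ x, G n x ≤ C)
    (hGinv : ∀ n, ∃ C : ℝ, ∀ x, 1 / G n x ≤ C * Real.exp (V x) ^ δ)
    (p n : ℕ) (hp : 0 < p) (hpn : p ≤ n)
    (F : (Fin (n + 1) → X) → ℝ) (hFmeas : Measurable F)
    (hFbdd : ∃ C : ℝ, ∀ ω, |F ω| ≤ C)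
    :
    ∀ᵐ xp ∂lam, ∀ ε : ℝ, 0 < ε →
      Tendsto (fun N : ℕ =>
          FK.particleLaw lam mu G H N n
            {traj | ε ≤
              |FK.Dop lam G H (FK.empSeq N n traj) p n F xp -
                FK.Dop lam G H (FK.eta lam mu G H) p n F xp|}) atTop (𝓝 0) := by
  have hr : FK.IsRegular lam G H := ⟨hGmeas, hGnonneg, hHmeas, hHnonneg, hHdens, hGbdd⟩
  obtain ⟨q, rfl⟩ : ∃ q, p = q + 1 := ⟨p - 1, by omega⟩
  obtain ⟨C, hC⟩ := hFbdd
  obtain ⟨M, hM⟩ := hr.exists_abs_Fpath_le (q + 1) (n - (q + 1)) C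
  filter_upwards [hr.ae_integrable_backWeight (mu := mu) q] with x hx ε hε
  simp only [FK.Dop, dif_pos hpn]
  refine hr.tendsto_particleLaw_Bpath q n (by omega) x hx ?_ (fun z => hM _ _ fun w => hC _) hε
  refine hr.measurable_Fpath (q + 1) (n - (q + 1)) measurable_const (hFmeas.comp ?_)
  exact measurable_pi_iff.2 fun i => (measurable_pi_apply _).comp
    (FK.measurable_append_snoc (q + 1) (n - (q + 1)) x)
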